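/- Let η = {η_u} be strictly positive weights satisfying Σ_{j≥1} η̃_j < ∞, where η̃_j := max_{v⊆{1,…,j−1}} η_{v∪{j}}/η_v. Let N = 2^n with n ∈ ℕ and let z = (z_1,…,z_s) be constructed by the CBC-DBD algorithm with weights η. Then for every δ > 0 and every α > 1 there exist constants C_α > 0 and C_δ > 0, independent of s and N, such that the worst-case error in E^α_{s,η^α} satisfies e_{N,s,α,η^α}(z) ≤ C_α/N^α + C_δ^α/N^{α(1−δ)}. -/

import Mathlib

open Finset MeasureTheory

noncomputable section

/-- `lsin a = log (1 / sin² (π a))`. -/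
def lsin (a : ℝ) : ℝ := Real.log (1 / Real.sin (Real.pi * a) ^ 2)

/-- The support of `m ∈ ℤ^s`, viewed as a subset of `{1,…,s} ⊂ ℕ`
(component `j : Fin s` corresponds to the index `j+1 ∈ {1,…,s}`). -/
def msupp {s : ℕ} (m : Fin s → ℤ) : Finset ℕ :=
  (Finset.univ.filter fun j => m j ≠ 0).image fun j : Fin s => (j : ℕ) + 1

/-- `r_{α,γ}(m) = γ_{supp(m)}⁻¹ ∏_{j ∈ supp(m)} |m_j|^α`. -/
def rweight {s : ℕ} (α : ℝ) (γ : Finset ℕ → ℝ) (m : Fin s → ℤ) : ℝ :=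
  (γ (msupp m))⁻¹ * ∏ j ∈ Finset.univ.filter (fun j => m j ≠ 0), |(m j : ℝ)| ^ α

/-- The truncated quantity
`T_{α,γ}(N,z) = ∑_{m ∈ M_{N,s}\{0}, m·z ≡ 0 (mod N)} 1 / r_{α,γ}(m)`,
where `M_{N,s} = {-(N-1),…,N-1}^s` and the components of `z` are `z 1, …, z s`. -/
def Tsum (α : ℝ) (γ : Finset ℕ → ℝ) (N s : ℕ) (z : ℕ → ℤ) : ℝ :=
  ∑ m ∈ (Fintype.piFinset fun _ : Fin s => Finset.Icc (-(N : ℤ) + 1) ((N : ℤ) - 1)).filter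
      (fun m => m ≠ 0 ∧ (∑ j : Fin s, m j * z ((j : ℕ) + 1)) % (N : ℤ) = 0),
    1 / rweight α γ m

/-- `H_{s,n,γ}(z) = ∑_{k=1}^{2^n-1} ∑_{∅≠u⊆{1,…,s}} γ_u ∏_{j∈u} log(1/sin²(π k z_j/2^n))`. -/
def Hsum (γ : Finset ℕ → ℝ) (s n : ℕ) (z : ℕ → ℤ) : ℝ :=
  ∑ k ∈ Finset.Icc (1:ℕ) (2 ^ n - 1),
    ∑ u ∈ (Finset.Icc 1 s).powerset.filter (· ≠ ∅),
      γ u * ∏ j ∈ u, lsin ((k : ℝ) * (z j : ℝ) / 2 ^ n)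

/-- The digit-wise quality function `h_{r,n,v,γ}(x)` (with previously chosen
components `z 1, …, z (r-1)`). -/
def hqual (γ : Finset ℕ → ℝ) (n v r : ℕ) (z : ℕ → ℤ) (x : ℤ) : ℝ :=
  ∑ t ∈ Finset.Icc v n, (1 / 2 ^ (t - v) : ℝ) *
    ∑ k ∈ (Finset.Icc (1:ℕ) (2 ^ t - 1)).filter (fun k => Odd k),
      ((∑ u ∈ (Finset.Icc 1 (r - 1)).powerset.filter (· ≠ ∅),
          γ u * ∏ j ∈ u, lsin ((k : ℝ) * (z j : ℝ) / 2 ^ t)) +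
        ∑ u ∈ (Finset.Icc 1 (r - 1)).powerset,
          γ (u ∪ {r}) * lsin ((k : ℝ) * (x : ℝ) / 2 ^ v) *
            ∏ j ∈ u, lsin ((k : ℝ) * (z j : ℝ) / 2 ^ t))

/-- `z = (z 1, …, z s)` is (a possible) output of the component-by-component
digit-by-digit construction (Algorithm 1) with inputs `n`, `s` and weights `γ`:
`z 1 = 1`, and for `r = 2,…,s` one has `z_{r,1} = 1` and for `v = 2,…,n`,
`z_{r,v} = z_{r,v-1} + z* 2^{v-1}` where `z* ∈ {0,1}` minimizes
`z ↦ h_{r,n,v,γ}(z_{r,v-1} + z 2^{v-1})`; finally `z r = z_{r,n}`. -/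
def IsCBCDBD (γ : Finset ℕ → ℝ) (n s : ℕ) (z : ℕ → ℤ) : Prop :=
  z 1 = 1 ∧
  ∃ zz : ℕ → ℕ → ℤ,
    ∀ r ∈ Finset.Icc 2 s, zz r 1 = 1 ∧ z r = zz r n ∧
      ∀ v ∈ Finset.Icc 2 n, ∃ zs ∈ ({0, 1} : Set ℤ),
        zz r v = zz r (v - 1) + zs * 2 ^ (v - 1) ∧
        ∀ w ∈ ({0, 1} : Set ℤ),
          hqual γ n v r z (zz r (v - 1) + zs * 2 ^ (v - 1)) ≤
            hqual γ n v r z (zz r (v - 1) + w * 2 ^ (v - 1))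

/-- The weights `γ ∪ v`, i.e. `(γ ∪ v)_u = γ_{u ∪ v}`. -/
def unionWeights (γ : Finset ℕ → ℝ) (v : Finset ℕ) : Finset ℕ → ℝ :=
  fun u => γ (u ∪ v)

/-- `γ̃_j = max_{v ⊆ {1,…,j-1}} γ_{v ∪ {j}} / γ_v`. -/
def tildeW (γ : Finset ℕ → ℝ) (j : ℕ) : ℝ :=
  (Finset.Icc 1 (j - 1)).powerset.sup' ⟨∅, Finset.empty_mem_powerset _⟩
    fun v => γ (insert j v) / γ v

/-- The unit cube `[0,1]^s`. -/
def cube (s : ℕ) : Set (Fin s → ℝ) := Set.univ.pi fun _ => Set.Icc 0 1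

/-- The Fourier coefficient `f̂(m) = ∫_{[0,1]^s} f(x) e^{-2πi m·x} dx`. -/
def fcoeff (s : ℕ) (f : (Fin s → ℝ) → ℂ) (m : Fin s → ℤ) : ℂ :=
  ∫ x in cube s,
    f x * Complex.exp (-(2 * (Real.pi : ℂ) * Complex.I) * ∑ j, (m j : ℂ) * (x j : ℂ))

/-- The rank-1 lattice rule `Q_{N,s}(f,z) = (1/N) ∑_{k=0}^{N-1} f({k z / N})`. -/
def qmc (N s : ℕ) (z : ℕ → ℤ) (f : (Fin s → ℝ) → ℂ) : ℂ :=
  (N : ℂ)⁻¹ * ∑ k ∈ Finset.range N,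
    f fun j => Int.fract ((k : ℝ) * (z ((j : ℕ) + 1) : ℝ) / (N : ℝ))

/-- The worst-case error `e_{N,s,α,γ}(z)` of the rank-1 lattice rule with generating
vector `z` in the unit ball of the space `E^α_{s,γ}` (whose elements are identified
with their continuous representatives). -/
def wce (N s : ℕ) (α : ℝ) (γ : Finset ℕ → ℝ) (z : ℕ → ℤ) : ℝ :=
  ⨆ f ∈ {f : (Fin s → ℝ) → ℂ |
      Continuous f ∧ ∀ m : Fin s → ℤ, ‖fcoeff s f m‖ * rweight α γ m ≤ 1},
    ‖(∫ x in cube s, f x) - qmc N s z f‖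

/-- For POD weights given by `(Γ_ℓ)` and `(γ_j)`:
`p_{m,ℓ,t}(k) = ∑_{u ⊆ {1,…,m}, |u| = ℓ} Γ_ℓ ∏_{j∈u} γ_j log(1/sin²(π k z_j/2^t))`. -/
def psum (Γ γw : ℕ → ℝ) (z : ℕ → ℤ) (m ℓ t : ℕ) (k : ℕ) : ℝ :=
  ∑ u ∈ (Finset.Icc 1 m).powerset.filter (fun u => u.card = ℓ),
    Γ ℓ * ∏ j ∈ u, γw j * lsin ((k : ℝ) * (z j : ℝ) / 2 ^ t)

section FourierPart

local instance instMSUAC : MeasureSpace UnitAddCircle := ⟨AddCircle.haarAddCircle⟩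
local instance instHaarUAC : Measure.IsAddHaarMeasure (volume : Measure UnitAddCircle) :=
  inferInstanceAs (Measure.IsAddHaarMeasure AddCircle.haarAddCircle)
local instance instProbUAC : IsProbabilityMeasure (volume : Measure UnitAddCircle) :=
  inferInstanceAs (IsProbabilityMeasure AddCircle.haarAddCircle)

open UnitAddTorus in
lemma mFourier_coe_apply {s : ℕ} (m : Fin s → ℤ) (x : Fin s → ℝ) :
    mFourier m (fun i => (x i : UnitAddCircle)) =
      Complex.exp ((2 * (Real.pi : ℂ) * Complex.I) * ∑ j, (m j : ℂ) * (x j : ℂ)) := by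
  simp only [mFourier, ContinuousMap.coe_mk, fourier_coe_apply]
  rw [← Complex.exp_sum, Finset.mul_sum]
  congr 1
  apply Finset.sum_congr rfl
  intro j _
  push_cast
  ring

lemma cube_compact (s : ℕ) : IsCompact (cube s) := isCompact_univ_pi fun _ => isCompact_Icc

lemma ioc_ae_cube (s : ℕ) : ({x : Fin s → ℝ | ∀ i, x i ∈ Set.Ioc ((0 : Fin s → ℝ) i) ((0 : Fin s → ℝ) i + 1)} : Set (Fin s → ℝ))
    =ᵐ[volume] cube s := by
  have h1 : ({x : Fin s → ℝ | ∀ i, x i ∈ Set.Ioc ((0 : Fin s → ℝ) i) ((0 : Fin s → ℝ) i + 1)} : Set (Fin s → ℝ)) =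
    Set.univ.pi fun i => Set.Ioc ((0 : Fin s → ℝ) i) ((1 : Fin s → ℝ) i) := by
    ext x; simp [Set.mem_pi]
  have h2 : cube s = Set.Icc (0 : Fin s → ℝ) 1 := by
    rw [cube, ← Set.pi_univ_Icc]; rfl
  rw [h1, h2]
  exact Measure.univ_pi_Ioc_ae_eq_Icc

open UnitAddTorus in
lemma fourier_series_cube (s : ℕ) (f : (Fin s → ℝ) → ℂ) (hf : Continuous f)
    (hs : Summable (fcoeff s f)) (x : Fin s → ℝ) (hx : x ∈ cube s) :
    HasSum (fun m : Fin s → ℤ => fcoeff s f m *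
      Complex.exp ((2 * (Real.pi : ℂ) * Complex.I) * ∑ j, (m j : ℂ) * (x j : ℂ))) (f x) := by
  let F : UnitAddTorus (Fin s) → ℂ := fun y => f (measurableEquivPiIoc 0 y).1
  have hFm : Measurable F := hf.measurable.comp
    (measurable_subtype_coe.comp (measurableEquivPiIoc (0 : Fin s → ℝ)).measurable)
  obtain ⟨C, hC⟩ := (cube_compact s).exists_bound_of_continuousOn hf.continuousOn
  have hFb : ∀ y, ‖F y‖ ≤ C := by
    intro y
    apply hC
    intro i _
    have := (measurableEquivPiIoc (0 : Fin s → ℝ) y).2 i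
    simp only [Pi.zero_apply, zero_add] at this
    exact ⟨this.1.le, this.2⟩
  have hFL : MemLp F 2 (volume : Measure (UnitAddTorus (Fin s))) :=
    MemLp.of_bound hFm.aestronglyMeasurable C (Filter.Eventually.of_forall hFb)
  have hFx : ∀ x : Fin s → ℝ, (∀ i, x i ∈ Set.Ioc ((0 : Fin s → ℝ) i) ((0 : Fin s → ℝ) i + 1)) →
      F (fun i => (x i : UnitAddCircle)) = f x := by
    intro x hx
    have := (measurableEquivPiIoc (0 : Fin s → ℝ)).apply_symm_apply ⟨x, hx⟩
    simp only [F]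
    rw [coe_symm_measurableEquivPiIoc_apply] at this
    rw [this]
  have hcoef : ∀ m, mFourierCoeff F m = fcoeff s f m := by
    intro m
    rw [mFourierCoeff, integral_preimage _ (0 : Fin s → ℝ), fcoeff,
      ← setIntegral_congr_set (ioc_ae_cube s)]
    apply setIntegral_congr_fun
    · exact MeasurableSet.univ_pi' (fun i => measurableSet_Ioc)
    · intro x hx
      simp only
      rw [mFourier_coe_apply, hFx x hx, smul_eq_mul, mul_comm]
      congr 2
      simp only [Pi.neg_apply, Int.cast_neg, neg_mul, Finset.sum_neg_distrib, mul_neg]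
  have hcoefL : ∀ m, mFourierCoeff (hFL.toLp F) m = fcoeff s f m := by
    intro m
    rw [← hcoef]
    apply integral_congr_ae
    filter_upwards [hFL.coeFn_toLp] with y hy
    rw [hy]
  have hL2 := hasSum_mFourier_series_L2 (hFL.toLp F)
  simp only [hcoefL] at hL2
  have hsumC : Summable (fun m : Fin s → ℤ => fcoeff s f m • (mFourier m : C(UnitAddTorus (Fin s), ℂ))) := by
    apply Summable.of_norm
    simp only [norm_smul, mFourier_norm, mul_one]
    exact hs.norm
  obtain ⟨g, hg⟩ := hsumC
  have hgL := (ContinuousMap.toLp 2 (volume : Measure (UnitAddTorus (Fin s))) ℂ (E := ℂ)).hasSum hg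
  have heq : ContinuousMap.toLp 2 (volume : Measure (UnitAddTorus (Fin s))) ℂ g = hFL.toLp F := by
    refine HasSum.unique ?_ hL2
    convert hgL using 2 with m
    rw [map_smul]
  have hae : g =ᵐ[volume] F := by
    have h1 := ContinuousMap.coeFn_toLp (p := 2) (𝕜 := ℂ) (volume : Measure (UnitAddTorus (Fin s))) g
    rw [heq] at h1
    exact h1.symm.trans hFL.coeFn_toLp
  have hae2 := (measurePreserving_equivPiIoc (0 : Fin s → ℝ)).symm.quasiMeasurePreserving.ae hae
  have hae3 : ∀ᵐ x ∂(volume.restrict (cube s)), g (fun i => ((x i : ℝ) : UnitAddCircle)) = f x := by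
    rw [← Measure.restrict_congr_set (ioc_ae_cube s)]
    rw [ae_restrict_iff_subtype (MeasurableSet.univ_pi' (fun i => measurableSet_Ioc))]
    filter_upwards [hae2] with p hp
    have hp' : g (fun i => ((p.1 i : ℝ) : UnitAddCircle)) =
      F (fun i => ((p.1 i : ℝ) : UnitAddCircle)) := hp
    rw [hp']
    exact hFx p.1 p.2
  have hcont : Continuous fun x : Fin s → ℝ => g (fun i => ((x i : ℝ) : UnitAddCircle)) := by
    apply g.continuous.comp
    refine continuous_pi fun i => ?_
    exact (AddCircle.continuous_mk' 1).comp (continuous_apply i)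
  have hEq := Measure.eqOn_of_ae_eq hae3 hcont.continuousOn hf.continuousOn (by
    rw [cube, interior_pi_set Set.finite_univ, closure_pi_set]
    apply Set.pi_mono
    intro i _
    rw [interior_Icc, closure_Ioo (by norm_num)])
  rw [← hEq hx]
  have := (ContinuousMap.evalCLM ℂ (fun i => ((x i : ℝ) : UnitAddCircle))).hasSum hg
  have h2 : (fun m : Fin s → ℤ => fcoeff s f m *
      Complex.exp ((2 * (Real.pi : ℂ) * Complex.I) * ∑ j, (m j : ℂ) * (x j : ℂ))) =
      fun m => (ContinuousMap.evalCLM ℂ fun i => ((x i : ℝ) : UnitAddCircle))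
        (fcoeff s f m • mFourier m) := by
    funext m
    rw [← mFourier_coe_apply]
    simp
  rw [h2]
  exact this

end FourierPart

lemma geom_char (N : ℕ) (hN : 0 < N) (q : ℤ) :
    (N : ℂ)⁻¹ * ∑ k ∈ Finset.range N,
      Complex.exp ((2 * (Real.pi : ℂ) * Complex.I) * ((k : ℂ) * (q : ℂ) / (N : ℂ))) =
    if (N : ℤ) ∣ q then 1 else 0 := by
  have hN' : (N : ℂ) ≠ 0 := by exact_mod_cast hN.ne'
  set w := Complex.exp ((2 * (Real.pi : ℂ) * Complex.I) * ((q : ℂ) / (N : ℂ))) with hw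
  have h1 : ∀ k : ℕ, Complex.exp ((2 * (Real.pi : ℂ) * Complex.I) * ((k : ℂ) * (q : ℂ) / (N : ℂ))) = w ^ k := by
    intro k
    rw [hw, ← Complex.exp_nat_mul]
    congr 1
    ring
  simp only [h1]
  split_ifs with h
  · obtain ⟨c, rfl⟩ := h
    have : w = 1 := by
      rw [hw, Complex.exp_eq_one_iff]
      refine ⟨c, ?_⟩
      push_cast
      field_simp
    simp [this, hN']
  · have hne : w ≠ 1 := by
      intro h1
      rw [hw, Complex.exp_eq_one_iff] at h1
      obtain ⟨c, hc⟩ := h1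
      apply h
      refine ⟨c, ?_⟩
      have h2 : (2 * (Real.pi : ℂ) * Complex.I) ≠ 0 := Complex.two_pi_I_ne_zero
      have h3 : (q : ℂ) / N = c := by
        apply mul_left_cancel₀ h2
        rw [hc]; ring
      rw [div_eq_iff hN'] at h3
      have h4 : q = c * N := by exact_mod_cast h3
      rw [h4]; ring
    have hwN : w ^ N = 1 := by
      rw [← h1, Complex.exp_eq_one_iff]
      exact ⟨q, by field_simp⟩
    rw [geom_sum_eq hne, hwN]
    simp

lemma err_bound (s N : ℕ) (hN : 0 < N) (z : ℕ → ℤ) (f : (Fin s → ℝ) → ℂ) (hf : Continuous f)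
    (hs : Summable (fcoeff s f)) (a : (Fin s → ℤ) → ℝ) (ha : ∀ m, ‖fcoeff s f m‖ ≤ a m) (B : ℝ)
    (hB : ∀ F : Finset (Fin s → ℤ),
      (∀ m ∈ F, m ≠ 0 ∧ (N : ℤ) ∣ ∑ j : Fin s, m j * z ((j : ℕ) + 1)) → ∑ m ∈ F, a m ≤ B) :
    ‖(∫ x in cube s, f x) - qmc N s z f‖ ≤ B := by
  have hpt : ∀ k : ℕ, HasSum (fun m : Fin s → ℤ => fcoeff s f m *
      Complex.exp ((2 * (Real.pi : ℂ) * Complex.I) *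
        ((k : ℂ) * ((∑ j : Fin s, m j * z ((j : ℕ) + 1) : ℤ) : ℂ) / (N : ℂ))))
      (f fun j => Int.fract ((k : ℝ) * (z ((j : ℕ) + 1) : ℝ) / (N : ℝ))) := by
    intro k
    have := fourier_series_cube s f hf hs
      (fun j => Int.fract ((k : ℝ) * (z ((j : ℕ) + 1) : ℝ) / (N : ℝ)))
      (fun i _ => ⟨Int.fract_nonneg _, (Int.fract_lt_one _).le⟩)
    convert this using 3 with m
    rw [Complex.exp_eq_exp_iff_exists_int]
    refine ⟨∑ j : Fin s, m j * ⌊(k : ℝ) * (z ((j : ℕ) + 1) : ℝ) / (N : ℝ)⌋, ?_⟩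
    simp only [Int.fract]
    push_cast
    rw [mul_comm _ (2 * (Real.pi : ℂ) * Complex.I), ← mul_add]
    congr 1
    rw [← Finset.sum_add_distrib, Finset.mul_sum, Finset.sum_div]
    apply Finset.sum_congr rfl
    intro j _
    ring
  have h1 := (hasSum_sum (s := Finset.range N) fun k _ => hpt k).mul_left ((N : ℂ)⁻¹)
  have h2 : HasSum (fun m : Fin s → ℤ => if (N : ℤ) ∣ ∑ j : Fin s, m j * z ((j : ℕ) + 1) then
      fcoeff s f m else 0) (qmc N s z f) := by
    have h3 : (fun m : Fin s → ℤ => if (N : ℤ) ∣ ∑ j : Fin s, m j * z ((j : ℕ) + 1) then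
      fcoeff s f m else 0) = fun m => (N : ℂ)⁻¹ * ∑ k ∈ Finset.range N, fcoeff s f m *
        Complex.exp ((2 * (Real.pi : ℂ) * Complex.I) *
        ((k : ℂ) * ((∑ j : Fin s, m j * z ((j : ℕ) + 1) : ℤ) : ℂ) / (N : ℂ))) := by
      funext m
      rw [← Finset.mul_sum, mul_left_comm, geom_char N hN]
      split_ifs <;> simp
    rw [h3]
    exact h1
  have h0 : fcoeff s f 0 = ∫ x in cube s, f x := by
    simp [fcoeff]
  have h3 := (hasSum_ite_eq (0 : Fin s → ℤ) (fcoeff s f 0)).sub h2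
  rw [h0] at h3
  refine le_of_tendsto h3.norm (Filter.Eventually.of_forall fun F => ?_)
  refine le_trans (norm_sum_le _ _) ?_
  refine le_trans ?_ (hB (F.filter fun m => m ≠ 0 ∧ (N : ℤ) ∣ ∑ j : Fin s, m j * z ((j : ℕ) + 1))
    (fun m hm => (Finset.mem_filter.1 hm).2))
  rw [Finset.sum_filter]
  refine Finset.sum_le_sum fun m _ => ?_
  by_cases hm : m = 0
  · subst hm
    simp [h0]
  · rw [if_neg hm]
    by_cases h4 : (N : ℤ) ∣ ∑ j : Fin s, m j * z ((j : ℕ) + 1)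
    · simpa [h4, hm] using ha m
    · simp [h4]

lemma lsin_nonneg (x : ℝ) : 0 ≤ lsin x := by
  unfold lsin
  rw [one_div, Real.log_inv]
  have := Real.log_nonpos (sq_nonneg (Real.sin (Real.pi * x))) (Real.sin_sq_le_one _)
  linarith

lemma lsin_add_int (x : ℝ) (q : ℤ) : lsin (x + q) = lsin x := by
  unfold lsin
  have : Real.pi * (x + q) = Real.pi * x + q * Real.pi := by ring
  rw [this, Real.sin_add_int_mul_pi]
  congr 2
  rw [mul_pow]
  have h : (((-1 : ℝ) ^ q) ^ 2) = 1 := by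
    rw [← zpow_natCast, zpow_comm]
    simp
  rw [h, one_mul]

lemma lsin_dup (x : ℝ) (h : Real.sin (Real.pi * (2 * x)) ≠ 0) :
    lsin x + lsin (x + 1 / 2) = lsin (2 * x) + Real.log 4 := by
  unfold lsin
  have e1 : Real.pi * (x + 1 / 2) = Real.pi * x + Real.pi / 2 := by ring
  have e2 : Real.pi * (2 * x) = 2 * (Real.pi * x) := by ring
  rw [e2, Real.sin_two_mul] at h
  rw [e1, Real.sin_add_pi_div_two, e2, Real.sin_two_mul]
  have hs : Real.sin (Real.pi * x) ≠ 0 := fun h0 => h (by rw [h0]; ring)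
  have hc : Real.cos (Real.pi * x) ≠ 0 := fun h0 => h (by rw [h0]; ring)
  rw [← Real.log_mul (by positivity) (by positivity), ← Real.log_mul (by positivity) (by norm_num)]
  congr 1
  field_simp
  norm_num

lemma sin_odd_ne (q : ℤ) (v : ℕ) (hq : Odd q) (hv : 1 ≤ v) :
    Real.sin (Real.pi * ((q : ℝ) / 2 ^ v)) ≠ 0 := by
  intro h
  rw [Real.sin_eq_zero_iff] at h
  obtain ⟨c, hc⟩ := h
  have h1 : (c : ℝ) = (q : ℝ) / 2 ^ v := by
    have := Real.pi_ne_zero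
    apply mul_right_cancel₀ this
    rw [hc]; ring
  rw [eq_div_iff (by positivity)] at h1
  have h2 : c * 2 ^ v = q := by exact_mod_cast h1
  obtain ⟨w, rfl⟩ := Nat.exists_eq_add_of_le hv
  rw [pow_add] at h2
  have : Even q := by rw [← h2]; exact ⟨c * 2 ^ w, by ring⟩
  exact (Int.not_even_iff_odd.2 hq) this

lemma lsin_half (k : ℕ) (hk : Odd k) : lsin ((k : ℝ) * ((1 : ℤ) : ℝ) / 2 ^ 1) = 0 := by
  obtain ⟨c, rfl⟩ := hk
  have : (((2 * c + 1 : ℕ) : ℝ) * ((1 : ℤ) : ℝ) / 2 ^ 1) = 1 / 2 + ((c : ℤ) : ℝ) := by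
    push_cast; ring
  rw [this, lsin_add_int]
  unfold lsin
  have : Real.pi * (1 / 2) = Real.pi / 2 := by ring
  rw [this, Real.sin_pi_div_two]
  simp

lemma cbc_step (A : ℕ → ℕ → ℝ) (hA : ∀ t k, 0 ≤ A t k) (n : ℕ) (hn : 1 ≤ n) (y : ℕ → ℤ)
    (h1 : y 1 = 1)
    (hs : ∀ v ∈ Finset.Icc 2 n, ∃ zs ∈ ({0, 1} : Set ℤ), y v = y (v - 1) + zs * 2 ^ (v - 1) ∧
      ∀ w ∈ ({0, 1} : Set ℤ),
        (∑ t ∈ Finset.Icc v n, (1 / 2 ^ (t - v) : ℝ) *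
          ∑ k ∈ (Finset.Icc (1:ℕ) (2 ^ t - 1)).filter (fun k => Odd k),
            A t k * lsin ((k : ℝ) * (y v : ℝ) / 2 ^ v)) ≤
        (∑ t ∈ Finset.Icc v n, (1 / 2 ^ (t - v) : ℝ) *
          ∑ k ∈ (Finset.Icc (1:ℕ) (2 ^ t - 1)).filter (fun k => Odd k),
            A t k * lsin ((k : ℝ) * ((y (v - 1) + w * 2 ^ (v - 1) : ℤ) : ℝ) / 2 ^ v))) :
    (∀ v, 1 ≤ v → v ≤ n → Odd (y v)) ∧
    ∑ t ∈ Finset.Icc 1 n, ∑ k ∈ (Finset.Icc (1:ℕ) (2 ^ t - 1)).filter (fun k => Odd k),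
      A t k * (lsin ((k : ℝ) * (y n : ℝ) / 2 ^ t) - Real.log 4) ≤ 0 := by
  have hodd : ∀ v, 1 ≤ v → v ≤ n → Odd (y v) := by
    intro v hv
    induction v, hv using Nat.le_induction with
    | base => intro _; rw [h1]; exact odd_one
    | succ v hv ih =>
      intro hvn
      obtain ⟨zs, -, he, -⟩ := hs (v + 1) (Finset.mem_Icc.2 ⟨by omega, hvn⟩)
      rw [he]
      simp only [Nat.add_sub_cancel]
      apply (ih (by omega)).add_even
      obtain ⟨w, rfl⟩ := Nat.exists_eq_add_of_le hv
      exact ⟨zs * 2 ^ w, by ring⟩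
  refine ⟨hodd, ?_⟩
  have hQ : ∀ v, 1 ≤ v → v ≤ n → ∑ t ∈ Finset.Icc 1 n, (1 / 2 ^ (t - v) : ℝ) *
      ∑ k ∈ (Finset.Icc (1:ℕ) (2 ^ t - 1)).filter (fun k => Odd k),
      A t k * (lsin ((k : ℝ) * (y v : ℝ) / 2 ^ (min t v)) - Real.log 4) ≤ 0 := by
    intro v hv
    induction v, hv using Nat.le_induction with
    | base =>
      intro _
      apply Finset.sum_nonpos
      intro t ht
      apply mul_nonpos_of_nonneg_of_nonpos (by positivity)
      apply Finset.sum_nonpos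
      intro k hk
      rw [min_eq_right (Finset.mem_Icc.1 ht).1, h1, lsin_half k (Finset.mem_filter.1 hk).2]
      apply mul_nonpos_of_nonneg_of_nonpos (hA _ _)
      have : 0 ≤ Real.log 4 := Real.log_nonneg (by norm_num)
      linarith
    | succ v hv ih =>
      intro hvn
      refine le_trans ?_ (ih (by omega))
      obtain ⟨zs, -, he, hmin⟩ := hs (v + 1) (Finset.mem_Icc.2 ⟨by omega, hvn⟩)
      simp only [Nat.add_sub_cancel] at he hmin
      have hsplit : ∀ φ : ℕ → ℝ, ∑ t ∈ Finset.Icc 1 n, φ t =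
          ∑ t ∈ Finset.Icc 1 v, φ t + ∑ t ∈ Finset.Icc (v + 1) n, φ t := by
        intro φ
        rw [← Finset.sum_union]
        · congr 1
          ext t; simp only [Finset.mem_Icc, Finset.mem_union]; omega
        · rw [Finset.disjoint_left]
          intro t; simp only [Finset.mem_Icc]; omega
      rw [hsplit, hsplit]
      apply add_le_add
      · apply le_of_eq
        apply Finset.sum_congr rfl
        intro t ht
        rw [Finset.mem_Icc] at ht
        rw [min_eq_left ht.2, min_eq_left (by omega), Nat.sub_eq_zero_of_le ht.2,
          Nat.sub_eq_zero_of_le (by omega)]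
        congr 1
        apply Finset.sum_congr rfl
        intro k _
        congr 2
        rw [he]
        obtain ⟨w, rfl⟩ := Nat.exists_eq_add_of_le ht.2
        rw [← lsin_add_int ((k : ℝ) * (y (t + w) : ℝ) / 2 ^ t) ((k : ℤ) * zs * 2 ^ w)]
        congr 1
        push_cast
        field_simp
        ring
      · have hm0 := hmin 0 (by simp)
        have hm1 := hmin 1 (by simp)
        have e1 : ∑ t ∈ Finset.Icc (v + 1) n, (1 / 2 ^ (t - (v + 1)) : ℝ) *
            ∑ k ∈ (Finset.Icc (1:ℕ) (2 ^ t - 1)).filter (fun k => Odd k),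
            A t k * (lsin ((k : ℝ) * (y (v + 1) : ℝ) / 2 ^ (min t (v + 1))) - Real.log 4) =
            (∑ t ∈ Finset.Icc (v + 1) n, (1 / 2 ^ (t - (v + 1)) : ℝ) *
          ∑ k ∈ (Finset.Icc (1:ℕ) (2 ^ t - 1)).filter (fun k => Odd k),
            A t k * lsin ((k : ℝ) * (y (v + 1) : ℝ) / 2 ^ (v + 1))) -
            ∑ t ∈ Finset.Icc (v + 1) n, (1 / 2 ^ (t - (v + 1)) : ℝ) *
            ∑ k ∈ (Finset.Icc (1:ℕ) (2 ^ t - 1)).filter (fun k => Odd k), A t k * Real.log 4 := by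
          rw [← Finset.sum_sub_distrib]
          apply Finset.sum_congr rfl
          intro t ht
          rw [← mul_sub, ← Finset.sum_sub_distrib, min_eq_right (Finset.mem_Icc.1 ht).1]
          simp only [mul_sub]
        have e2 : ∑ t ∈ Finset.Icc (v + 1) n, (1 / 2 ^ (t - v) : ℝ) *
            ∑ k ∈ (Finset.Icc (1:ℕ) (2 ^ t - 1)).filter (fun k => Odd k),
            A t k * (lsin ((k : ℝ) * (y v : ℝ) / 2 ^ (min t v)) - Real.log 4) =
            ((∑ t ∈ Finset.Icc (v + 1) n, (1 / 2 ^ (t - (v + 1)) : ℝ) *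
          ∑ k ∈ (Finset.Icc (1:ℕ) (2 ^ t - 1)).filter (fun k => Odd k),
            A t k * lsin ((k : ℝ) * ((y v + 0 * 2 ^ v : ℤ) : ℝ) / 2 ^ (v + 1))) +
            (∑ t ∈ Finset.Icc (v + 1) n, (1 / 2 ^ (t - (v + 1)) : ℝ) *
          ∑ k ∈ (Finset.Icc (1:ℕ) (2 ^ t - 1)).filter (fun k => Odd k),
            A t k * lsin ((k : ℝ) * ((y v + 1 * 2 ^ v : ℤ) : ℝ) / 2 ^ (v + 1)))) / 2 -
            ∑ t ∈ Finset.Icc (v + 1) n, (1 / 2 ^ (t - (v + 1)) : ℝ) *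
            ∑ k ∈ (Finset.Icc (1:ℕ) (2 ^ t - 1)).filter (fun k => Odd k), A t k * Real.log 4 := by
          rw [← Finset.sum_add_distrib, Finset.sum_div, ← Finset.sum_sub_distrib]
          apply Finset.sum_congr rfl
          intro t ht
          rw [Finset.mem_Icc] at ht
          rw [← mul_add, mul_div_assoc, ← mul_sub, ← Finset.sum_add_distrib, Finset.sum_div,
            ← Finset.sum_sub_distrib, min_eq_right (by omega : v ≤ t)]
          have : t - v = (t - (v + 1)) + 1 := by omega
          rw [this, pow_succ, one_div_mul_eq_div, ← div_div]
          rw [one_div_mul_eq_div, div_right_comm, Finset.sum_div]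
          congr 1
          apply Finset.sum_congr rfl
          intro k hk
          have hkodd := (Finset.mem_filter.1 hk).2
          have hne := sin_odd_ne ((k : ℤ) * y v) v
            ((by exact_mod_cast hkodd : Odd (k : ℤ)).mul (hodd v hv (by omega))) hv
          have hd := lsin_dup ((k : ℝ) * (y v : ℝ) / 2 ^ (v + 1)) (by
            convert hne using 3
            push_cast
            field_simp
            ring)
          have g1 : 2 * ((k : ℝ) * (y v : ℝ) / 2 ^ (v + 1)) = (k : ℝ) * (y v : ℝ) / 2 ^ v := by
            field_simp; ring
          rw [g1] at hd
          have g2 : lsin ((k : ℝ) * ((y v + 1 * 2 ^ v : ℤ) : ℝ) / 2 ^ (v + 1)) =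
              lsin ((k : ℝ) * (y v : ℝ) / 2 ^ (v + 1) + 1 / 2) := by
            obtain ⟨c, rfl⟩ := hkodd
            rw [← lsin_add_int (_ + 1 / 2) (c : ℤ)]
            congr 1
            push_cast
            field_simp
            ring
          rw [g2]
          simp only [zero_mul, add_zero]
          linear_combination (-(A t k) / 2) * hd
        rw [e1, e2]
        linarith
  have := hQ n hn le_rfl
  convert this using 2 with t ht
  rw [Finset.mem_Icc] at ht
  rw [Nat.sub_eq_zero_of_le ht.2, min_eq_left ht.2]
  simp

lemma sum_levels (φ : ℝ → ℝ) (n : ℕ) :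
    ∑ k ∈ Finset.Icc (1:ℕ) (2 ^ n - 1), φ ((k : ℝ) / 2 ^ n) =
      ∑ t ∈ Finset.Icc 1 n, ∑ k ∈ (Finset.Icc (1:ℕ) (2 ^ t - 1)).filter (fun k => Odd k),
        φ ((k : ℝ) / 2 ^ t) := by
  induction n with
  | zero => simp
  | succ n ih =>
    rw [Finset.sum_Icc_succ_top (by omega), ← ih, ← Finset.sum_filter_add_sum_filter_not
      (Finset.Icc (1:ℕ) (2 ^ (n + 1) - 1)) (fun k => Odd k), add_comm]
    congr 1
    symm
    apply Finset.sum_bij (fun (k : ℕ) _ => 2 * k)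
    · intro k hk
      simp only [Finset.mem_Icc, Finset.mem_filter, pow_succ] at hk ⊢
      refine ⟨by omega, ?_⟩
      rw [Nat.not_odd_iff_even]
      exact even_two_mul k
    · intro a _ b _ h
      simpa using h
    · intro b hb
      simp only [Finset.mem_Icc, Finset.mem_filter, pow_succ, Nat.not_odd_iff_even] at hb
      obtain ⟨c, hc⟩ := hb.2
      refine ⟨c, ?_, by omega⟩
      simp only [Finset.mem_Icc]
      omega
    · intro k _
      congr 1
      push_cast
      field_simp
      ring

lemma lsin_zero : lsin 0 = 0 := by simp [lsin]

lemma sin_pos_frac (k : ℕ) (M : ℝ) (hk : 0 < k) (h : (k : ℝ) < M) :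
    0 < Real.sin (Real.pi * ((k : ℝ) / M)) := by
  have hk' : (0 : ℝ) < k := by exact_mod_cast hk
  have hM : 0 < M := hk'.trans h
  apply Real.sin_pos_of_pos_of_lt_pi
  · have := Real.pi_pos
    positivity
  · have h1 : (k : ℝ) / M < 1 := (div_lt_one hM).2 h
    have := Real.pi_pos
    nlinarith

lemma sum_lsin_range (n : ℕ) :
    ∑ k ∈ Finset.range (2 ^ n), lsin ((k : ℝ) / 2 ^ n) = ((2 : ℝ) ^ n - 1 - n) * Real.log 4 := by
  induction n with
  | zero => simp [lsin_zero]
  | succ n ih =>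
    have h2 : 2 ^ (n + 1) = 2 ^ n + 2 ^ n := by ring
    rw [h2, Finset.sum_range_add, ← Finset.sum_add_distrib]
    have : ∀ k ∈ Finset.range (2 ^ n), lsin ((k : ℝ) / 2 ^ (n + 1)) +
        lsin (((2 ^ n + k : ℕ) : ℝ) / 2 ^ (n + 1)) =
        lsin ((k : ℝ) / 2 ^ n) + (Real.log 4 - if k = 0 then Real.log 4 else 0) := by
      intro k hk
      have e : ((2 ^ n + k : ℕ) : ℝ) / 2 ^ (n + 1) = (k : ℝ) / 2 ^ (n + 1) + 1 / 2 := by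
        push_cast; field_simp; ring
      rw [e]
      by_cases h0 : k = 0
      · subst h0
        have := lsin_half 1 odd_one
        norm_num at this
        rw [one_div] at this
        simp [lsin_zero, this]
      · have e2 : 2 * ((k : ℝ) / 2 ^ (n + 1)) = (k : ℝ) / 2 ^ n := by field_simp; ring
        rw [lsin_dup, e2]
        · simp [h0]
        · rw [e2]
          apply ne_of_gt
          apply sin_pos_frac k _ (Nat.pos_of_ne_zero h0)
          have := Finset.mem_range.1 hk
          exact_mod_cast this
    rw [Finset.sum_congr rfl this, Finset.sum_add_distrib, ih, Finset.sum_sub_distrib]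
    simp
    ring

lemma range_eq_Icc (n : ℕ) (φ : ℕ → ℝ) :
    ∑ k ∈ Finset.range (2 ^ n), φ k = φ 0 + ∑ k ∈ Finset.Icc 1 (2 ^ n - 1), φ k := by
  have h : Finset.range (2 ^ n) = insert 0 (Finset.Icc 1 (2 ^ n - 1)) := by
    ext k
    have := Nat.one_le_two_pow (n := n)
    simp only [Finset.mem_range, Finset.mem_insert, Finset.mem_Icc]
    omega
  rw [h, Finset.sum_insert (by simp)]

lemma cbc_main (η : Finset ℕ → ℝ) (hη : ∀ u, 0 < η u) (n s : ℕ) (hn : 1 ≤ n) (z : ℕ → ℤ)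
    (h : IsCBCDBD η n s z) :
    (∀ r ∈ Finset.Icc 1 s, Odd (z r)) ∧ ∀ r ∈ Finset.Icc 1 s,
      ∑ k ∈ Finset.Icc (1:ℕ) (2 ^ n - 1), ∑ u ∈ (Finset.Icc 1 (r - 1)).powerset,
        η (u ∪ {r}) * ((∏ j ∈ u, lsin ((k : ℝ) * (z j : ℝ) / 2 ^ n)) *
          (lsin ((k : ℝ) * (z r : ℝ) / 2 ^ n) - Real.log 4)) ≤ 0 := by
  obtain ⟨hz1, zz, hzz⟩ := h
  have key : ∀ r ∈ Finset.Icc 2 s, Odd (z r) ∧ 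
      ∑ k ∈ Finset.Icc (1:ℕ) (2 ^ n - 1), ∑ u ∈ (Finset.Icc 1 (r - 1)).powerset,
        η (u ∪ {r}) * ((∏ j ∈ u, lsin ((k : ℝ) * (z j : ℝ) / 2 ^ n)) *
          (lsin ((k : ℝ) * (z r : ℝ) / 2 ^ n) - Real.log 4)) ≤ 0 := by
    intro r hr
    obtain ⟨h1, h2, h3⟩ := hzz r hr
    obtain ⟨g1, g2⟩ := cbc_step (fun t k => ∑ u ∈ (Finset.Icc 1 (r - 1)).powerset,
        η (u ∪ {r}) * ∏ j ∈ u, lsin ((k : ℝ) * (z j : ℝ) / 2 ^ t))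
      (fun t k => Finset.sum_nonneg fun u _ => mul_nonneg (hη _).le
        (Finset.prod_nonneg fun j _ => lsin_nonneg _)) n hn (zz r) h1 (by
        intro v hv
        obtain ⟨zs, hzs, he, hmin⟩ := h3 v hv
        refine ⟨zs, hzs, he, fun w hw => ?_⟩
        have := hmin w hw
        rw [← he] at this
        unfold hqual at this
        simp only [Finset.sum_add_distrib, mul_add, add_le_add_iff_left] at this
        simp only [Finset.sum_mul]
        convert this using 5
        · ring
        · ring)
    rw [← h2] at g2
    refine ⟨h2 ▸ g1 n hn le_rfl, ?_⟩
    have := sum_levels (fun x => ∑ u ∈ (Finset.Icc 1 (r - 1)).powerset,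
        η (u ∪ {r}) * ((∏ j ∈ u, lsin (x * (z j : ℝ))) *
          (lsin (x * (z r : ℝ)) - Real.log 4))) n
    simp only [div_mul_eq_mul_div] at this
    rw [this]
    convert g2 using 4
    rw [Finset.sum_mul]
    apply Finset.sum_congr rfl
    intro u _
    ring
  constructor
  · intro r hr
    rw [Finset.mem_Icc] at hr
    rcases Nat.lt_or_ge r 2 with h | h
    · have : r = 1 := by omega
      rw [this, hz1]; exact odd_one
    · exact (key r (Finset.mem_Icc.2 ⟨h, hr.2⟩)).1
  · intro r hr
    rw [Finset.mem_Icc] at hr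
    rcases Nat.lt_or_ge r 2 with h | h
    · have : r = 1 := by omega
      subst this
      simp only [Nat.sub_self, Finset.Icc_eq_empty (show ¬ (1 ≤ 0) by omega),
        Finset.powerset_empty, Finset.sum_singleton, Finset.prod_empty, one_mul, hz1, Int.cast_one,
        mul_one]
      rw [← Finset.mul_sum]
      apply mul_nonpos_of_nonneg_of_nonpos (hη _).le
      have h1 := sum_lsin_range n
      rw [range_eq_Icc n (fun k => lsin ((k : ℝ) / 2 ^ n))] at h1
      simp only [Nat.cast_zero, zero_div, lsin_zero, zero_add] at h1
      rw [Finset.sum_sub_distrib, h1]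
      have h4 : 0 ≤ Real.log 4 := Real.log_nonneg (by norm_num)
      simp only [Finset.sum_const, Nat.card_Icc, nsmul_eq_mul]
      have : ((2 ^ n - 1 + 1 - 1 : ℕ) : ℝ) = 2 ^ n - 1 := by
        rw [Nat.add_sub_cancel, Nat.cast_sub Nat.one_le_two_pow]; simp
      rw [this]
      have : (0 : ℝ) ≤ n := by positivity
      nlinarith
    · exact (key r (Finset.mem_Icc.2 ⟨h, hr.2⟩)).2

/-- Real cosine transform on `ZMod N`. -/
def hatK {N : ℕ} [NeZero N] (K : ZMod N → ℝ) (a : ZMod N) : ℝ :=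
  (N : ℝ)⁻¹ * ∑ k, K k * (ZMod.stdAddChar (k * a) : ℂ).re

lemma sum_re_char {N : ℕ} [NeZero N] (a : ZMod N) :
    ∑ k : ZMod N, (ZMod.stdAddChar (k * a) : ℂ).re = if a = 0 then (N : ℝ) else 0 := by
  have := AddChar.sum_mulShift a (ZMod.isPrimitive_stdAddChar N)
  rw [← Complex.re_sum, this]
  split_ifs <;> simp [ZMod.card]

lemma char_re_mul {N : ℕ} [NeZero N] (a b : ZMod N) :
    (ZMod.stdAddChar a : ℂ).re * (ZMod.stdAddChar b : ℂ).re =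
      ((ZMod.stdAddChar (a + b) : ℂ).re + (ZMod.stdAddChar (a - b) : ℂ).re) / 2 := by
  have h : (ZMod.stdAddChar (-b) : ℂ) = (starRingEnd ℂ) (ZMod.stdAddChar b) := by
    rw [AddChar.map_neg_eq_conj]
  rw [sub_eq_add_neg, AddChar.map_add_eq_mul, AddChar.map_add_eq_mul, h]
  simp

lemma sum_re_re {N : ℕ} [NeZero N] (m h : ZMod N) :
    (if m = h then (N : ℝ) / 2 else 0) ≤
      ∑ k : ZMod N, (ZMod.stdAddChar (k * m) : ℂ).re * (ZMod.stdAddChar (k * h) : ℂ).re := by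
  simp only [char_re_mul, ← mul_add, ← mul_sub]
  rw [← Finset.sum_div, Finset.sum_add_distrib, sum_re_char, sum_re_char]
  have hN : (0 : ℝ) ≤ N := by positivity
  by_cases e : m = h
  · simp only [e, sub_self, if_true]
    split_ifs <;> linarith
  · simp only [e, sub_eq_zero, if_false]
    split_ifs <;> linarith

lemma Lr_sum {N : ℕ} [NeZero N] (r : ℝ) (h0 : 0 < r) (h1 : r < 1) (h : ℕ) (hh : 1 ≤ h) :
    N * r ^ h / h ≤ ∑ k : ZMod N, -Real.log (‖1 - (r : ℂ) * ZMod.stdAddChar k‖ ^ 2) *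
      (ZMod.stdAddChar (k * (h : ZMod N)) : ℂ).re := by
  have H : ∀ k : ZMod N, HasSum (fun m : ℕ => 2 * r ^ m / m *
      ((ZMod.stdAddChar (k * (m : ZMod N)) : ℂ).re * (ZMod.stdAddChar (k * (h : ZMod N)) : ℂ).re))
      (-Real.log (‖1 - (r : ℂ) * ZMod.stdAddChar k‖ ^ 2) *
      (ZMod.stdAddChar (k * (h : ZMod N)) : ℂ).re) := by
    intro k
    have hn : ‖(r : ℂ) * ZMod.stdAddChar k‖ < 1 := by
      rw [norm_mul, AddChar.norm_apply, mul_one, Complex.norm_real, Real.norm_of_nonneg h0.le]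
      exact h1
    have := Complex.hasSum_re (Complex.hasSum_taylorSeries_neg_log hn)
    have h2 := (this.mul_left 2).mul_right ((ZMod.stdAddChar (k * (h : ZMod N)) : ℂ).re)
    convert h2 using 1
    · rfl
    · funext m
      have e : (ZMod.stdAddChar (k * (m : ZMod N)) : ℂ) = ZMod.stdAddChar k ^ m := by
        rw [mul_comm, ← nsmul_eq_mul, AddChar.map_nsmul_eq_pow]
      rw [mul_pow, ← e]
      have e2 : (r : ℂ) ^ m * ZMod.stdAddChar (k * (m : ZMod N)) / (m : ℂ) =
        ((r ^ m / m : ℝ) : ℂ) * ZMod.stdAddChar (k * (m : ZMod N)) := by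
        push_cast; ring
      rw [e2, Complex.re_ofReal_mul]
      ring
    · rw [Complex.neg_re, Complex.log_re, Real.log_pow]
      push_cast; ring
  have H2 := hasSum_sum (s := Finset.univ) (fun k _ => H k)
  have key : ∀ m : ℕ, (if (m : ZMod N) = h then (N : ℝ) / 2 else 0) * (2 * r ^ m / m) ≤
      ∑ k : ZMod N, 2 * r ^ m / m * ((ZMod.stdAddChar (k * (m : ZMod N)) : ℂ).re *
        (ZMod.stdAddChar (k * (h : ZMod N)) : ℂ).re) := by
    intro m
    rw [← Finset.mul_sum, mul_comm]
    exact mul_le_mul_of_nonneg_left (sum_re_re _ _) (by positivity)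
  have := le_hasSum H2 h (fun m _ => le_trans (by split_ifs <;> positivity) (key m))
  refine le_trans (le_trans (le_of_eq ?_) (key h)) this
  simp
  ring

lemma sin_lower (N k : ℕ) (hk : 0 < k) (h : k < N) :
    2 / (N : ℝ) ≤ Real.sin (Real.pi * ((k : ℝ) / N)) := by
  have hN : (0 : ℝ) < N := by exact_mod_cast hk.trans h
  have hk' : (1 : ℝ) ≤ k := by exact_mod_cast hk
  have hpi := Real.pi_pos
  rcases le_total (2 * k) N with h2 | h2
  · have h2' : 2 * (k : ℝ) ≤ N := by exact_mod_cast h2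
    have := Real.mul_le_sin (x := Real.pi * ((k : ℝ) / N)) (by positivity) (by
      rw [mul_div_assoc', div_le_div_iff₀ hN (by norm_num)]; nlinarith)
    refine le_trans ?_ this
    have e : 2 / Real.pi * (Real.pi * ((k : ℝ) / N)) = 2 * k / N := by field_simp
    rw [e]
    gcongr
    linarith
  · have h2' : (N : ℝ) ≤ 2 * k := by exact_mod_cast h2
    have h3 : (k : ℝ) + 1 ≤ N := by exact_mod_cast h
    have e0 : Real.pi - Real.pi * ((k : ℝ) / N) = Real.pi * (((N : ℝ) - k) / N) := by
      field_simp
    have := Real.mul_le_sin (x := Real.pi - Real.pi * ((k : ℝ) / N)) (by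
      rw [e0]; apply mul_nonneg hpi.le; apply div_nonneg <;> linarith) (by
      rw [e0, mul_div_assoc', div_le_div_iff₀ hN (by norm_num)]; nlinarith)
    rw [Real.sin_pi_sub, e0] at this
    refine le_trans ?_ this
    have e : 2 / Real.pi * (Real.pi * (((N : ℝ) - k) / N)) = 2 * (N - k) / N := by field_simp
    rw [e]
    gcongr
    linarith

lemma norm_sq_char {N : ℕ} [NeZero N] (r : ℝ) (k : ZMod N) :
    ‖1 - (r : ℂ) * ZMod.stdAddChar k‖ ^ 2 =
      (1 - r) ^ 2 + 4 * r * Real.sin (Real.pi * ((k.val : ℝ) / N)) ^ 2 := by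
  have e : (ZMod.stdAddChar k : ℂ) =
      Complex.exp (((2 * (Real.pi * ((k.val : ℝ) / N)) : ℝ) : ℂ) * Complex.I) := by
    have := ZMod.stdAddChar_coe (N := N) (k.val : ℤ)
    rw [Int.cast_natCast, ZMod.natCast_zmod_val] at this
    rw [this]
    congr 1
    push_cast
    ring
  rw [e, Complex.sq_norm, Complex.normSq_apply]
  simp only [Complex.sub_re, Complex.one_re, Complex.re_ofReal_mul, Complex.exp_ofReal_mul_I_re,
    Complex.sub_im, Complex.one_im, Complex.im_ofReal_mul, Complex.exp_ofReal_mul_I_im]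
  generalize Real.pi * ((k.val : ℝ) / N) = x
  have h1 := Real.sin_sq_add_cos_sq (2 * x)
  have h2 := Real.cos_two_mul x
  have h3 := Real.sin_sq_add_cos_sq x
  have h4 : Real.sin x ^ 2 = (1 - Real.cos (2 * x)) / 2 := by linarith
  rw [h4]
  linear_combination r ^ 2 * h1


/-- The kernel: `Z` at zero and `lsin (k/N) - c` elsewhere. -/
def GK (N : ℕ) (c : ℝ) (k : ZMod N) : ℝ :=
  if k = 0 then 4 * Real.log N + 6 else lsin ((k.val : ℝ) / N) - c

lemma lsin_approx (N k : ℕ) (hN : 2 ≤ N) (hk : 0 < k) (h : k < N) (r : ℝ)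
    (hr : r = 1 - 1 / (N : ℝ) ^ 2) :
    |lsin ((k : ℝ) / N) - Real.log 4 -
      -Real.log ((1 - r) ^ 2 + 4 * r * Real.sin (Real.pi * ((k : ℝ) / N)) ^ 2)| ≤
        2 / (N : ℝ) ^ 2 := by
  have hs := sin_lower N k hk h
  set S := Real.sin (Real.pi * ((k : ℝ) / N)) with hS
  have hN' : (2 : ℝ) ≤ N := by exact_mod_cast hN
  have hS0 : 0 < S := lt_of_lt_of_le (by positivity) hs
  set ε := 1 / (N : ℝ) ^ 2 with hε
  have hε0 : 0 < ε := by positivity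
  have hε4 : ε ≤ 1 / 4 := by
    rw [hε]; apply one_div_le_one_div_of_le (by norm_num); nlinarith
  have hS2 : 4 * ε ≤ S ^ 2 := by
    have : (2 / (N : ℝ)) ^ 2 ≤ S ^ 2 := by gcongr
    refine le_trans (le_of_eq ?_) this
    rw [hε]; ring
  have hA : 0 < (1 - r) ^ 2 + 4 * r * S ^ 2 := by
    have : 0 < r := by linarith
    positivity
  have e : lsin ((k : ℝ) / N) - Real.log 4 - -Real.log ((1 - r) ^ 2 + 4 * r * S ^ 2) =
      Real.log (((1 - r) ^ 2 + 4 * r * S ^ 2) / (4 * S ^ 2)) := by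
    rw [Real.log_div hA.ne' (by positivity), Real.log_mul (by norm_num) (by positivity), lsin, ← hS,
      one_div, Real.log_inv]
    ring
  rw [e]
  have hq1 : ((1 - r) ^ 2 + 4 * r * S ^ 2) / (4 * S ^ 2) ≤ 1 := by
    rw [div_le_one (by positivity), hr]
    nlinarith
  have hq2 : 1 - ε ≤ ((1 - r) ^ 2 + 4 * r * S ^ 2) / (4 * S ^ 2) := by
    rw [le_div_iff₀ (by positivity), hr]
    nlinarith [sq_nonneg ε]
  have hq0 : 0 < ((1 - r) ^ 2 + 4 * r * S ^ 2) / (4 * S ^ 2) := by positivity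
  rw [abs_of_nonpos (Real.log_nonpos hq0.le hq1)]
  have h3 := Real.one_sub_inv_le_log_of_pos (show 0 < 1 - ε by linarith)
  have h4 := Real.log_le_log (by linarith) hq2
  have h5 : (1 - ε)⁻¹ ≤ 1 + 2 * ε := by
    rw [inv_le_iff_one_le_mul₀ (by linarith)]
    nlinarith
  have h6 : 2 / (N : ℝ) ^ 2 = 2 * ε := by rw [hε]; ring
  rw [h6]
  linarith

lemma sum_GK {N : ℕ} [NeZero N] (c : ℝ) (φ : ZMod N → ℝ) :
    ∑ k, GK N c k * φ k = (4 * Real.log N + 6) * φ 0 +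
      ∑ k ∈ Finset.univ.erase 0, (lsin (((k : ZMod N).val : ℝ) / N) - c) * φ k := by
  rw [← Finset.add_sum_erase _ _ (Finset.mem_univ (0 : ZMod N))]
  congr 1
  · simp [GK]
  · apply Finset.sum_congr rfl
    intro k hk
    rw [GK, if_neg (Finset.ne_of_mem_erase hk)]

lemma hat_G_lower {N : ℕ} [NeZero N] (hN : 2 ≤ N) (c : ℝ) (hc : 0 ≤ c) (h : ℕ) (hh : 1 ≤ h)
    (hhN : h < N) :
    1 / (h : ℝ) ≤ hatK (GK N c) (h : ZMod N) := by
  have hN' : (2 : ℝ) ≤ N := by exact_mod_cast hN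
  have hN0 : (0 : ℝ) < N := by linarith
  have hh' : (1 : ℝ) ≤ h := by exact_mod_cast hh
  set r : ℝ := 1 - 1 / (N : ℝ) ^ 2 with hr
  have hε4 : 1 / (N : ℝ) ^ 2 ≤ 1 / 4 := by
    apply one_div_le_one_div_of_le (by norm_num); nlinarith
  have hε0 : 0 < 1 / (N : ℝ) ^ 2 := by positivity
  have L := Lr_sum (N := N) r (by linarith) (by linarith) h hh
  have hne : (h : ZMod N) ≠ 0 := by
    rw [Ne, ZMod.natCast_eq_zero_iff]
    exact Nat.not_dvd_of_pos_of_lt hh hhN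
  set φ : ZMod N → ℝ := fun k => (ZMod.stdAddChar (k * (h : ZMod N)) : ℂ).re with hφ
  have hφ0 : φ 0 = 1 := by simp [hφ]
  have hφ1 : ∀ k, |φ k| ≤ 1 := by
    intro k
    refine le_trans (Complex.abs_re_le_norm _) ?_
    rw [AddChar.norm_apply]
  have hs : ∑ k ∈ Finset.univ.erase 0, φ k = -1 := by
    have := sum_re_char (N := N) (h : ZMod N)
    rw [if_neg hne, ← Finset.add_sum_erase _ _ (Finset.mem_univ (0 : ZMod N))] at this
    change φ 0 + ∑ k ∈ Finset.univ.erase 0, φ k = 0 at this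
    linarith
  have L2 : N * r ^ h / h - 4 * Real.log N ≤ ∑ k ∈ Finset.univ.erase 0,
      -Real.log ((1 - r) ^ 2 + 4 * r * Real.sin (Real.pi * (((k : ZMod N).val : ℝ) / N)) ^ 2) *
        φ k := by
    rw [← Finset.add_sum_erase _ _ (Finset.mem_univ (0 : ZMod N))] at L
    simp only [norm_sq_char] at L
    change _ ≤ _ * φ 0 + ∑ k ∈ Finset.univ.erase 0, _ * φ k at L
    have e : -Real.log ((1 - r) ^ 2 + 4 * r * Real.sin (Real.pi * (((0 : ZMod N).val : ℝ) / N)) ^ 2)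
        * φ 0 = 4 * Real.log N := by
      rw [hφ0, ZMod.val_zero]
      have : (1 - r) = ((N : ℝ) ^ 2)⁻¹ := by rw [hr]; ring
      rw [this]
      simp [Real.log_pow]
      ring
    rw [e] at L
    linarith
  have L3 : ∑ k ∈ Finset.univ.erase 0,
      -Real.log ((1 - r) ^ 2 + 4 * r * Real.sin (Real.pi * (((k : ZMod N).val : ℝ) / N)) ^ 2) *
        φ k ≤ ∑ k ∈ Finset.univ.erase 0,
      ((lsin (((k : ZMod N).val : ℝ) / N) - c) * φ k + (c - Real.log 4) * φ k
        + 2 / (N : ℝ) ^ 2) := by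
    apply Finset.sum_le_sum
    intro k hk
    have hk0 : 0 < k.val := Nat.pos_of_ne_zero (by
      rw [Ne, ZMod.val_eq_zero]; exact Finset.ne_of_mem_erase hk)
    have A := lsin_approx N k.val hN hk0 (ZMod.val_lt k) r hr
    set X := lsin ((k.val : ℝ) / N)
    set Y := -Real.log ((1 - r) ^ 2 + 4 * r * Real.sin (Real.pi * ((k.val : ℝ) / N)) ^ 2)
    have B : |(X - Real.log 4 - Y) * φ k| ≤ 2 / (N : ℝ) ^ 2 := by
      rw [abs_mul]
      exact (mul_le_of_le_one_right (abs_nonneg _) (hφ1 k)).trans A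
    have := neg_le_of_abs_le B
    nlinarith
  rw [Finset.sum_add_distrib, Finset.sum_add_distrib, ← Finset.mul_sum, hs, Finset.sum_const,
    Finset.card_erase_of_mem (Finset.mem_univ _), Finset.card_univ, ZMod.card, nsmul_eq_mul] at L3
  have hb : ((N - 1 : ℕ) : ℝ) * (2 / (N : ℝ) ^ 2) ≤ 1 := by
    rw [Nat.cast_sub (by omega), Nat.cast_one, mul_div_assoc', div_le_one (by positivity)]
    nlinarith
  have hbern : (N : ℝ) / h - 1 ≤ N * r ^ h / h := by
    have := one_add_mul_le_pow (a := -(1 / (N : ℝ) ^ 2)) (by linarith) h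
    have e : 1 + -(1 / (N : ℝ) ^ 2) = r := by rw [hr]; ring
    rw [e] at this
    have h2 : (N : ℝ) / h - 1 / N ≤ N * r ^ h / h := by
      calc (N : ℝ) / h - 1 / N = N * (1 + (h : ℝ) * -(1 / (N : ℝ) ^ 2)) / h := by
            field_simp
            ring
        _ ≤ _ := by gcongr
    have h3 : 1 / (N : ℝ) ≤ 1 := by rw [div_le_one hN0]; linarith
    linarith
  have hl4 : Real.log 4 ≤ 2 := by
    have : Real.log 4 = 2 * Real.log 2 := by
      rw [show (4 : ℝ) = 2 ^ 2 by norm_num, Real.log_pow]; norm_num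
    rw [this]
    linarith [Real.log_two_lt_d9]
  rw [hatK, ← div_eq_inv_mul, le_div_iff₀ hN0]
  change _ ≤ ∑ k, GK N c k * φ k
  rw [sum_GK, hφ0]
  have e : 1 / (h : ℝ) * N = N / h := by ring
  rw [e]
  linarith

lemma hatK_neg {N : ℕ} [NeZero N] (K : ZMod N → ℝ) (a : ZMod N) : hatK K (-a) = hatK K a := by
  unfold hatK
  congr 1
  apply Finset.sum_congr rfl
  intro k _
  rw [mul_neg, AddChar.map_neg_eq_conj, Complex.conj_re]

lemma hat_G_int {N : ℕ} [NeZero N] (hN : 2 ≤ N) (c : ℝ) (hc : 0 ≤ c) (h : ℤ) (hh : h ≠ 0)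
    (hhN : 2 * |h| ≤ N) : 1 / |(h : ℝ)| ≤ hatK (GK N c) (h : ZMod N) := by
  rw [Int.abs_eq_natAbs] at hhN
  have h1 : 1 ≤ h.natAbs := by omega
  have h2 : h.natAbs < N := by omega
  have := hat_G_lower hN c hc h.natAbs h1 h2
  have e : ((h.natAbs : ℕ) : ℝ) = |(h : ℝ)| := by
    rw [Nat.cast_natAbs, Int.cast_abs]
  rw [e] at this
  rcases Int.natAbs_eq h with h3 | h3
  · have e2 : (h : ZMod N) = (h.natAbs : ZMod N) := by
      conv_lhs => rw [h3]
      rw [Int.cast_natCast]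
    rwa [e2]
  · have e2 : (h : ZMod N) = -(h.natAbs : ZMod N) := by
      conv_lhs => rw [h3]
      rw [Int.cast_neg, Int.cast_natCast]
    rwa [e2, hatK_neg]

lemma hat_G_nonneg {N : ℕ} [NeZero N] (hN : 2 ≤ N) (c : ℝ) (hc : 0 ≤ c)
    (h0 : 0 ≤ hatK (GK N c) 0) (a : ZMod N) : 0 ≤ hatK (GK N c) a := by
  by_cases ha : a = 0
  · rwa [ha]
  · have := hat_G_int hN c hc a.valMinAbs (by rwa [Ne, ZMod.valMinAbs_eq_zero]) (by
      have := ZMod.natAbs_valMinAbs_le a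
      rw [Int.abs_eq_natAbs]
      omega)
    rw [ZMod.coe_valMinAbs] at this
    exact le_trans (by positivity) this

lemma zmod_sum_eq {N : ℕ} [NeZero N] (φ : ℕ → ℝ) :
    ∑ k : ZMod N, φ k.val = ∑ k ∈ Finset.range N, φ k := by
  symm
  apply Finset.sum_bij (fun (k : ℕ) _ => (k : ZMod N))
  · intros; exact Finset.mem_univ _
  · intro a ha b hb h
    have := congrArg ZMod.val h
    rwa [ZMod.val_natCast_of_lt (Finset.mem_range.1 ha),
      ZMod.val_natCast_of_lt (Finset.mem_range.1 hb)] at this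
  · intro b _
    exact ⟨b.val, Finset.mem_range.2 (ZMod.val_lt b), ZMod.natCast_zmod_val b⟩
  · intro k hk
    rw [ZMod.val_natCast_of_lt (Finset.mem_range.1 hk)]

lemma hat_G_zero (n : ℕ) (c : ℝ) (hc : c ≤ Real.log 4) :
    0 ≤ hatK (GK (2 ^ n) c) 0 := by
  rw [hatK]
  apply mul_nonneg (by positivity)
  rw [sum_GK (N := 2 ^ n) c (fun k => (ZMod.stdAddChar (k * 0) : ℂ).re)]
  simp only [mul_zero, AddChar.map_zero_eq_one, Complex.one_re, mul_one]
  have h1 : ∑ k ∈ Finset.univ.erase 0, lsin (((k : ZMod (2 ^ n)).val : ℝ) / (2 ^ n : ℕ)) =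
      ((2 : ℝ) ^ n - 1 - n) * Real.log 4 := by
    rw [← sum_lsin_range n, ← zmod_sum_eq (N := 2 ^ n) (fun k => lsin ((k : ℝ) / 2 ^ n)),
      ← Finset.add_sum_erase _ _ (Finset.mem_univ (0 : ZMod (2 ^ n)))]
    simp [lsin_zero]
  rw [Finset.sum_sub_distrib, h1, Finset.sum_const, Finset.card_erase_of_mem (Finset.mem_univ _),
    Finset.card_univ, ZMod.card, nsmul_eq_mul, Nat.cast_sub Nat.one_le_two_pow]
  push_cast
  rw [Real.log_pow]
  have h4 : Real.log 4 = 2 * Real.log 2 := by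
    rw [show (4 : ℝ) = 2 ^ 2 by norm_num, Real.log_pow]; norm_num
  have h5 : (1 : ℝ) ≤ 2 ^ n := one_le_pow₀ (by norm_num)
  have h6 : 0 < Real.log 2 := Real.log_pos (by norm_num)
  have h7 : (0 : ℝ) ≤ n * Real.log 2 := by positivity
  have h8 : ((2 : ℝ) ^ n - 1) * c ≤ (2 ^ n - 1) * Real.log 4 :=
    mul_le_mul_of_nonneg_left hc (by linarith)
  nlinarith

lemma char_real_sum {N : ℕ} [NeZero N] (K : ZMod N → ℝ) (hK : ∀ k, K (-k) = K k) (a : ZMod N) :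
    ((hatK K a : ℝ) : ℂ) = (N : ℂ)⁻¹ * ∑ k, (K k : ℂ) * ZMod.stdAddChar (k * a) := by
  have hconj : (starRingEnd ℂ) (∑ k, (K k : ℂ) * ZMod.stdAddChar (k * a)) =
      ∑ k, (K k : ℂ) * ZMod.stdAddChar (k * a) := by
    rw [map_sum]
    rw [← Equiv.sum_comp (Equiv.neg (ZMod N))]
    apply Finset.sum_congr rfl
    intro k _
    rw [map_mul, Complex.conj_ofReal, ← AddChar.map_neg_eq_conj]
    simp [hK]
  have := Complex.conj_eq_iff_re.1 hconj
  rw [← this, hatK, Complex.re_sum]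
  simp only [Complex.re_ofReal_mul]
  push_cast
  rfl

lemma char_inv {N : ℕ} [NeZero N] (K : ZMod N → ℝ) (hK : ∀ k, K (-k) = K k) (k : ZMod N) :
    (K k : ℂ) = ∑ a, ((hatK K a : ℝ) : ℂ) * ZMod.stdAddChar (a * k) := by
  have hN : (N : ℂ) ≠ 0 := Nat.cast_ne_zero.2 (NeZero.ne N)
  simp only [char_real_sum K hK]
  have e : ∀ a : ZMod N, (N : ℂ)⁻¹ * (∑ l, (K l : ℂ) * ZMod.stdAddChar (l * a)) *
      ZMod.stdAddChar (a * k) =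
      ∑ l, (N : ℂ)⁻¹ * (K l : ℂ) * ZMod.stdAddChar (a * (l + k)) := by
    intro a
    rw [mul_assoc, Finset.sum_mul, Finset.mul_sum]
    apply Finset.sum_congr rfl
    intro l _
    rw [mul_add, AddChar.map_add_eq_mul, mul_comm l a]
    ring
  simp only [e]
  rw [Finset.sum_comm]
  have e2 : ∀ l : ZMod N, ∑ a, (N : ℂ)⁻¹ * (K l : ℂ) * ZMod.stdAddChar (a * (l + k)) =
      if l = -k then (K l : ℂ) else 0 := by
    intro l
    rw [← Finset.mul_sum, AddChar.sum_mulShift _ (ZMod.isPrimitive_stdAddChar N), ZMod.card]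
    by_cases h : l = -k
    · rw [if_pos h, if_pos (by rw [h]; ring)]
      field_simp
    · rw [if_neg h, if_neg (fun h2 => h (eq_neg_of_add_eq_zero_left h2))]
      simp
  simp only [e2]
  simp [hK]

lemma char_map_sum {N : ℕ} [NeZero N] {ι : Type*} (S : Finset ι) (f : ι → ZMod N) :
    (ZMod.stdAddChar (∑ i ∈ S, f i) : ℂ) = ∏ i ∈ S, (ZMod.stdAddChar (f i) : ℂ) := by
  classical
  induction S using Finset.induction_on with
  | empty => simp
  | insert a S ha ih =>
    rw [Finset.sum_insert ha, Finset.prod_insert ha, AddChar.map_add_eq_mul, ih]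

lemma dual_sum {N : ℕ} [NeZero N] (s : ℕ) (K : Fin s → ZMod N → ℝ)
    (hK : ∀ j k, K j (-k) = K j k) (w : Fin s → ZMod N) :
    ∑ k, ∏ j, K j (k * w j) =
      N * ∑ a : Fin s → ZMod N, if ∑ j, a j * w j = 0 then ∏ j, hatK (K j) (a j) else 0 := by
  apply Complex.ofReal_injective
  push_cast
  have e : ∀ k : ZMod N, ∏ j, (K j (k * w j) : ℂ) =
      ∑ a : Fin s → ZMod N, (∏ j, ((hatK (K j) (a j) : ℝ) : ℂ)) *
        ZMod.stdAddChar (k * ∑ j, a j * w j) := by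
    intro k
    rw [Finset.prod_congr rfl (fun j _ => char_inv (K j) (hK j) (k * w j)),
      Finset.prod_univ_sum, Fintype.piFinset_univ]
    apply Finset.sum_congr rfl
    intro a _
    rw [Finset.prod_mul_distrib, ← char_map_sum, Finset.mul_sum]
    congr 3
    funext j
    ring
  simp only [e]
  rw [Finset.sum_comm, Finset.mul_sum]
  apply Finset.sum_congr rfl
  intro a _
  rw [← Finset.mul_sum, AddChar.sum_mulShift _ (ZMod.isPrimitive_stdAddChar N), ZMod.card]
  split_ifs
  · push_cast; ring
  · simp

lemma dual_lower {N : ℕ} [NeZero N] (s : ℕ) (K : Fin s → ZMod N → ℝ)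
    (hK : ∀ j k, K j (-k) = K j k) (hpos : ∀ j a, 0 ≤ hatK (K j) a) (z : Fin s → ℤ)
    (F : Finset (Fin s → ℤ))
    (hF : ∀ m ∈ F, (∀ j, 2 * |m j| < N) ∧ (N : ℤ) ∣ ∑ j, m j * z j) :
    N * ∑ m ∈ F, ∏ j, hatK (K j) (m j : ZMod N) ≤ ∑ k, ∏ j, K j (k * (z j : ZMod N)) := by
  rw [dual_sum s K hK]
  apply mul_le_mul_of_nonneg_left _ (by positivity)
  have inj : Set.InjOn (fun (m : Fin s → ℤ) (j : Fin s) => (m j : ZMod N)) F := by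
    intro m hm m' hm' h
    funext j
    have h1 := congrFun h j
    simp only at h1
    rw [ZMod.intCast_eq_intCast_iff_dvd_sub] at h1
    have h2 := (hF m hm).1 j
    have h3 := (hF m' hm').1 j
    have h4 : |m' j - m j| < N := by
      have := abs_sub (m' j) (m j)
      linarith
    have := Int.eq_zero_of_abs_lt_dvd h1 h4
    linarith
  have e : ∑ m ∈ F, ∏ j, hatK (K j) (m j : ZMod N) =
      ∑ a ∈ F.image (fun (m : Fin s → ℤ) (j : Fin s) => (m j : ZMod N)),
        if ∑ j, a j * (z j : ZMod N) = 0 then ∏ j, hatK (K j) (a j) else 0 := by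
    rw [Finset.sum_image inj]
    apply Finset.sum_congr rfl
    intro m hm
    rw [if_pos]
    have := (ZMod.intCast_zmod_eq_zero_iff_dvd _ N).2 (hF m hm).2
    push_cast at this
    exact this
  rw [e]
  apply Finset.sum_le_sum_of_subset_of_nonneg (Finset.subset_univ _)
  intro a _ _
  split_ifs
  · exact Finset.prod_nonneg fun j _ => hpos j _
  · exact le_rfl

lemma GK_even {N : ℕ} [NeZero N] (c : ℝ) (k : ZMod N) : GK N c (-k) = GK N c k := by
  unfold GK
  by_cases h : k = 0
  · simp [h]
  · have hN : (N : ℝ) ≠ 0 := Nat.cast_ne_zero.2 (NeZero.ne N)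
    rw [if_neg (neg_ne_zero.2 h), if_neg h, ZMod.neg_val, if_neg h,
      Nat.cast_sub (ZMod.val_lt k).le]
    congr 1
    unfold lsin
    congr 3
    have : Real.pi * (((N : ℝ) - k.val) / N) = Real.pi - Real.pi * ((k.val : ℝ) / N) := by
      field_simp
    rw [this, Real.sin_pi_sub]

lemma GK_int {N : ℕ} [NeZero N] (c : ℝ) (x : ℤ) (hx : ¬ (N : ℤ) ∣ x) :
    GK N c (x : ZMod N) = lsin ((x : ℝ) / N) - c := by
  have hN : (N : ℝ) ≠ 0 := Nat.cast_ne_zero.2 (NeZero.ne N)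
  rw [GK, if_neg (by rwa [ZMod.intCast_zmod_eq_zero_iff_dvd])]
  congr 1
  have h1 : (((x : ZMod N).val : ℤ) : ℝ) = ((x % N : ℤ) : ℝ) := by
    rw [ZMod.val_intCast]
  rw [Int.cast_natCast] at h1
  have h2 : (x : ℝ) = ((x % N : ℤ) : ℝ) + N * ((x / N : ℤ) : ℝ) := by
    exact_mod_cast (Int.emod_add_mul_ediv x N).symm
  rw [h1]
  conv_rhs => rw [h2, add_div, mul_div_cancel_left₀ _ hN, lsin_add_int]

lemma hat_one {N : ℕ} [NeZero N] (a : ZMod N) :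
    hatK (fun _ : ZMod N => (1 : ℝ)) a = if a = 0 then 1 else 0 := by
  have hN : (N : ℝ) ≠ 0 := Nat.cast_ne_zero.2 (NeZero.ne N)
  unfold hatK
  simp only [one_mul]
  rw [sum_re_char]
  split_ifs <;> simp [hN]

lemma prod_fin_Icc (s : ℕ) (f : ℕ → ℝ) :
    ∏ j : Fin s, f ((j : ℕ) + 1) = ∏ i ∈ Finset.Icc 1 s, f i := by
  rw [Fin.prod_univ_eq_prod_range (fun j => f (j + 1)) s, Finset.range_eq_Ico,
    Finset.prod_Ico_add' f 0 s 1]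
  rfl

/-- The kernel family for the set `u ∪ {r}`. -/
def KK (N : ℕ) (u : Finset ℕ) (r : ℕ) (i : ℕ) : ZMod N → ℝ :=
  if i = r then GK N (Real.log 4) else if i ∈ u then GK N 0 else fun _ => 1

lemma prod_KK (N s r : ℕ) (hr : r ∈ Finset.Icc 1 s) (u : Finset ℕ) (hu : u ⊆ Finset.Icc 1 (r - 1))
    (x : ℕ → ZMod N) :
    ∏ j : Fin s, KK N u r ((j : ℕ) + 1) (x ((j : ℕ) + 1)) =
      (∏ j ∈ u, GK N 0 (x j)) * GK N (Real.log 4) (x r) := by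
  rw [prod_fin_Icc s (fun i => KK N u r i (x i))]
  have hru : r ∉ u := by
    intro h
    have h1 := Finset.mem_Icc.1 (hu h)
    have h2 := Finset.mem_Icc.1 hr
    omega
  have hsub : insert r u ⊆ Finset.Icc 1 s := by
    intro i hi
    rcases Finset.mem_insert.1 hi with h | h
    · rwa [h]
    · have h1 := Finset.mem_Icc.1 (hu h)
      have h2 := Finset.mem_Icc.1 hr
      exact Finset.mem_Icc.2 (by omega)
  rw [← Finset.prod_subset hsub, Finset.prod_insert hru, mul_comm]
  · congr 1
    · apply Finset.prod_congr rfl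
      intro i hi
      have : i ≠ r := fun h => hru (h ▸ hi)
      simp [KK, this, hi]
    · simp [KK]
  · intro i _ hi
    rw [Finset.mem_insert, not_or] at hi
    simp [KK, hi.1, hi.2]

lemma KK_even {N : ℕ} [NeZero N] (u : Finset ℕ) (r i : ℕ) (k : ZMod N) :
    KK N u r i (-k) = KK N u r i k := by
  unfold KK
  split_ifs
  · exact GK_even _ _
  · exact GK_even _ _
  · rfl

lemma hat_KK_nonneg (n : ℕ) (hn : 1 ≤ n) (u : Finset ℕ) (r i : ℕ) (a : ZMod (2 ^ n)) :
    0 ≤ hatK (KK (2 ^ n) u r i) a := by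
  have h2 : 2 ≤ 2 ^ n := by
    calc 2 = 2 ^ 1 := rfl
      _ ≤ 2 ^ n := Nat.pow_le_pow_right (by norm_num) hn
  have h4 : 0 ≤ Real.log 4 := Real.log_nonneg (by norm_num)
  unfold KK
  split_ifs
  · exact hat_G_nonneg h2 _ h4 (hat_G_zero n _ le_rfl) a
  · exact hat_G_nonneg h2 _ le_rfl (hat_G_zero n _ h4) a
  · rw [hat_one]; split_ifs <;> norm_num

lemma mem_msupp {s : ℕ} (m : Fin s → ℤ) (j : Fin s) : (j : ℕ) + 1 ∈ msupp m ↔ m j ≠ 0 := by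
  unfold msupp
  simp only [Finset.mem_image, Finset.mem_filter, Finset.mem_univ, true_and]
  constructor
  · rintro ⟨i, hi, h⟩
    have : i = j := Fin.ext (by omega)
    rwa [← this]
  · intro h
    exact ⟨j, h, rfl⟩

lemma msupp_sub {s : ℕ} (m : Fin s → ℤ) : msupp m ⊆ Finset.Icc 1 s := by
  intro i hi
  unfold msupp at hi
  simp only [Finset.mem_image, Finset.mem_filter, Finset.mem_univ, true_and] at hi
  obtain ⟨j, _, rfl⟩ := hi
  have := j.2
  exact Finset.mem_Icc.2 (by omega)

lemma prod_hat_KK (n s r : ℕ) (hn : 1 ≤ n) (u : Finset ℕ) (m : Fin s → ℤ)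
    (hm : ∀ j, 2 * |m j| < (2 ^ n : ℕ)) (hs : msupp m = u ∪ {r}) :
    ∏ j ∈ Finset.univ.filter (fun j => m j ≠ 0), 1 / |(m j : ℝ)| ≤
      ∏ j : Fin s, hatK (KK (2 ^ n) u r ((j : ℕ) + 1)) (m j : ZMod (2 ^ n)) := by
  have h2 : 2 ≤ 2 ^ n := by
    calc 2 = 2 ^ 1 := rfl
      _ ≤ 2 ^ n := Nat.pow_le_pow_right (by norm_num) hn
  have h4 : 0 ≤ Real.log 4 := Real.log_nonneg (by norm_num)
  rw [Finset.prod_filter]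
  apply Finset.prod_le_prod
  · intro j _
    split_ifs <;> positivity
  · intro j _
    have hj := mem_msupp m j
    rw [hs, Finset.mem_union, Finset.mem_singleton] at hj
    by_cases h0 : m j = 0
    · have : ¬ ((j : ℕ) + 1 ∈ u ∨ (j : ℕ) + 1 = r) := fun h => hj.1 h h0
      rw [not_or] at this
      rw [KK, if_neg this.2, if_neg this.1, hat_one, h0]
      simp
    · rw [if_pos h0]
      have hm' := (hm j).le
      unfold KK
      split_ifs with h5 h6
      · exact hat_G_int h2 _ h4 _ h0 hm'
      · exact hat_G_int h2 _ le_rfl _ h0 hm'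
      · exact absurd (hj.2 h0) (by tauto)

/-- `ρ(m) = η_{supp m} ∏ 1/|m_j|`. -/
def rho {s : ℕ} (η : Finset ℕ → ℝ) (m : Fin s → ℤ) : ℝ :=
  η (msupp m) * ∏ j ∈ Finset.univ.filter (fun j => m j ≠ 0), 1 / |(m j : ℝ)|

lemma zmod_sum_nat {N : ℕ} [NeZero N] (φ : ZMod N → ℝ) :
    ∑ k : ZMod N, φ k = ∑ k ∈ Finset.range N, φ (k : ZMod N) := by
  rw [← zmod_sum_eq (fun k => φ (k : ZMod N))]
  simp

lemma small_r (η : Finset ℕ → ℝ) (hη : ∀ u, 0 < η u) (n s : ℕ) (hn : 1 ≤ n) (z : ℕ → ℤ)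
    (hodd : ∀ r ∈ Finset.Icc 1 s, Odd (z r))
    (r : ℕ) (hr : r ∈ Finset.Icc 1 s)
    (hcbc : ∑ k ∈ Finset.Icc (1:ℕ) (2 ^ n - 1), ∑ u ∈ (Finset.Icc 1 (r - 1)).powerset,
        η (u ∪ {r}) * ((∏ j ∈ u, lsin ((k : ℝ) * (z j : ℝ) / 2 ^ n)) *
          (lsin ((k : ℝ) * (z r : ℝ) / 2 ^ n) - Real.log 4)) ≤ 0)
    (F : Finset (Fin s → ℤ))
    (hF : ∀ m ∈ F, (∀ j, 2 * |m j| < (2 ^ n : ℕ)) ∧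
      ((2 ^ n : ℕ) : ℤ) ∣ ∑ j : Fin s, m j * z ((j : ℕ) + 1)) :
    (2 : ℝ) ^ n * ∑ u ∈ (Finset.Icc 1 (r - 1)).powerset, ∑ m ∈ F.filter (fun m => msupp m = u ∪ {r}),
        rho η m ≤
      ∑ u ∈ (Finset.Icc 1 (r - 1)).powerset, η (u ∪ {r}) *
        (4 * Real.log ((2 : ℝ) ^ n) + 6) ^ (u.card + 1) := by
  have hr' := Finset.mem_Icc.1 hr
  have step : ∀ u ∈ (Finset.Icc 1 (r - 1)).powerset,
      (2 : ℝ) ^ n * ∑ m ∈ F.filter (fun m => msupp m = u ∪ {r}), rho η m ≤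
        η (u ∪ {r}) * ((4 * Real.log ((2 : ℝ) ^ n) + 6) ^ (u.card + 1) +
          ∑ k ∈ Finset.Icc (1:ℕ) (2 ^ n - 1),
            (∏ j ∈ u, lsin ((k : ℝ) * (z j : ℝ) / 2 ^ n)) *
          (lsin ((k : ℝ) * (z r : ℝ) / 2 ^ n) - Real.log 4)) := by
    intro u hu
    rw [Finset.mem_powerset] at hu
    have e1 : ∑ m ∈ F.filter (fun m => msupp m = u ∪ {r}), rho η m =
        η (u ∪ {r}) * ∑ m ∈ F.filter (fun m => msupp m = u ∪ {r}),
          ∏ j ∈ Finset.univ.filter (fun j => m j ≠ 0), 1 / |(m j : ℝ)| := by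
      rw [Finset.mul_sum]
      apply Finset.sum_congr rfl
      intro m hm
      rw [rho, (Finset.mem_filter.1 hm).2]
    rw [e1, mul_left_comm]
    apply mul_le_mul_of_nonneg_left _ (hη _).le
    have D := dual_lower (N := 2 ^ n) s (fun j => KK (2 ^ n) u r ((j : ℕ) + 1))
      (fun j k => KK_even u r _ k) (fun j a => hat_KK_nonneg n hn u r _ a)
      (fun j => z ((j : ℕ) + 1)) (F.filter (fun m => msupp m = u ∪ {r}))
      (fun m hm => hF m (Finset.mem_filter.1 hm).1)
    have e2 : ∑ k : ZMod (2 ^ n), ∏ j : Fin s,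
        KK (2 ^ n) u r ((j : ℕ) + 1) (k * (z ((j : ℕ) + 1) : ZMod (2 ^ n))) =
        (4 * Real.log ((2 : ℝ) ^ n) + 6) ^ (u.card + 1) +
          ∑ k ∈ Finset.Icc (1:ℕ) (2 ^ n - 1),
            (∏ j ∈ u, lsin ((k : ℝ) * (z j : ℝ) / 2 ^ n)) *
          (lsin ((k : ℝ) * (z r : ℝ) / 2 ^ n) - Real.log 4) := by
      rw [zmod_sum_nat]
      have : ∀ k : ℕ, ∏ j : Fin s,
        KK (2 ^ n) u r ((j : ℕ) + 1) ((k : ZMod (2 ^ n)) * (z ((j : ℕ) + 1) : ZMod (2 ^ n))) =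
          (∏ j ∈ u, GK (2 ^ n) 0 ((k : ZMod (2 ^ n)) * (z j : ZMod (2 ^ n)))) *
            GK (2 ^ n) (Real.log 4) ((k : ZMod (2 ^ n)) * (z r : ZMod (2 ^ n))) := fun k =>
        prod_KK (2 ^ n) s r hr u hu (fun i => (k : ZMod (2 ^ n)) * (z i : ZMod (2 ^ n)))
      simp only [this]
      rw [range_eq_Icc]
      congr 1
      · simp [GK, pow_succ]
      · apply Finset.sum_congr rfl
        intro k hk
        have hk' := Finset.mem_Icc.1 hk
        have hG : ∀ c : ℝ, ∀ i ∈ Finset.Icc 1 s,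
            GK (2 ^ n) c ((k : ZMod (2 ^ n)) * (z i : ZMod (2 ^ n))) =
            lsin ((k : ℝ) * (z i : ℝ) / 2 ^ n) - c := by
          intro c i hi
          have := GK_int (N := 2 ^ n) c ((k : ℤ) * z i) (by
            intro hd
            have hcop : IsCoprime (((2 ^ n : ℕ) : ℤ)) (z i) := by
              push_cast
              apply IsCoprime.pow_left
              obtain ⟨q, hq⟩ := hodd i hi
              exact ⟨-q, 1, by rw [hq]; ring⟩
            have h1 := hcop.dvd_of_dvd_mul_right hd
            have h2 := Nat.le_of_dvd (by omega) (Int.natCast_dvd_natCast.1 h1)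
            have := Nat.one_le_two_pow (n := n)
            omega)
          push_cast at this
          exact this
        rw [hG _ r hr]
        congr 1
        apply Finset.prod_congr rfl
        intro i hi
        have := Finset.mem_Icc.1 (hu hi)
        rw [hG _ i (Finset.mem_Icc.2 (by omega)), sub_zero]
    rw [e2] at D
    refine le_trans ?_ D
    push_cast
    apply mul_le_mul_of_nonneg_left _ (by positivity)
    apply Finset.sum_le_sum
    intro m hm
    have hm' := Finset.mem_filter.1 hm
    exact prod_hat_KK n s r hn u m (hF m hm'.1).1 hm'.2
  rw [Finset.mul_sum]
  refine le_trans (Finset.sum_le_sum step) ?_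
  simp only [mul_add, Finset.sum_add_distrib, Finset.mul_sum]
  rw [Finset.sum_comm] at hcbc
  linarith

lemma tildeW_pos (η : Finset ℕ → ℝ) (hη : ∀ u, 0 < η u) (j : ℕ) : 0 < tildeW η j := by
  have h : η (insert j ∅) / η ∅ ≤ tildeW η j :=
    Finset.le_sup' (fun v => η (insert j v) / η v) (Finset.empty_mem_powerset _)
  exact lt_of_lt_of_le (div_pos (hη _) (hη _)) h

lemma eta_le (η : Finset ℕ → ℝ) (hη : ∀ u, 0 < η u) (h0 : η ∅ = 1) (u : Finset ℕ)
    (hu : ∀ j ∈ u, 1 ≤ j) : η u ≤ ∏ j ∈ u, tildeW η j := by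
  induction u using Finset.induction_on_max with
  | empty => simp [h0]
  | insert a v hv ih =>
    have hav : a ∉ v := fun h => lt_irrefl _ (hv a h)
    rw [Finset.prod_insert hav]
    have h1 := ih (fun j hj => hu j (Finset.mem_insert_of_mem hj))
    have h2 : η (insert a v) / η v ≤ tildeW η a :=
      Finset.le_sup' (fun v => η (insert a v) / η v) (Finset.mem_powerset.2 (by
        intro j hj
        have := hv j hj
        have := hu j (Finset.mem_insert_of_mem hj)
        exact Finset.mem_Icc.2 (by omega)))
    rw [div_le_iff₀ (hη _)] at h2
    exact h2.trans (mul_le_mul_of_nonneg_left h1 (tildeW_pos η hη a).le)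

lemma tele (x : ℕ → ℝ) (s : ℕ) :
    ∑ r ∈ Finset.Icc 1 s, ∑ u ∈ (Finset.Icc 1 (r - 1)).powerset, x r * ∏ j ∈ u, x j =
      ∏ j ∈ Finset.Icc 1 s, (1 + x j) - 1 := by
  induction s with
  | zero => simp
  | succ s ih =>
    rw [Finset.sum_Icc_succ_top (by omega), Finset.prod_Icc_succ_top (by omega), ih,
      ← Finset.mul_sum, Nat.add_sub_cancel, ← Finset.prod_one_add]
    ring

lemma prod_growth (T : ℕ → ℝ) (hT : ∀ j, 0 ≤ T j) (hs : Summable T) (ε : ℝ) (hε : 0 < ε) :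
    ∃ C > (0 : ℝ), ∀ (s : ℕ) (Z : ℝ), 0 ≤ Z →
      ∏ j ∈ Finset.range s, (1 + T j * Z) ≤ C * Real.exp (ε * Z) := by
  obtain ⟨J, hJ⟩ := (summable_iff_vanishing_norm.1 hs) (ε / 2) (by positivity)
  obtain ⟨K, hK⟩ : ∃ K, ∀ j ∈ J, j < K := ⟨J.sup id + 1, fun j hj =>
    Nat.lt_succ_of_le (Finset.le_sup (f := id) hj)⟩
  set e := ε / (2 * ((K : ℝ) + 1)) with he
  have he0 : 0 < e := by positivity
  refine ⟨∏ j ∈ Finset.range K, (1 + T j / e), Finset.prod_pos fun j _ => by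
    have := hT j; positivity, ?_⟩
  intro s Z hZ
  have h1 : ∏ j ∈ Finset.range s, (1 + T j * Z) ≤ ∏ j ∈ Finset.range (max K s), (1 + T j * Z) := by
    rw [← Finset.prod_range_mul_prod_Ico _ (le_max_right K s)]
    apply le_mul_of_one_le_right
    · exact Finset.prod_nonneg fun j _ => by have := hT j; positivity
    · refine le_trans (le_of_eq (Finset.prod_const_one (s := Finset.Ico s (max K s))).symm) ?_
      apply Finset.prod_le_prod
      · intros; norm_num
      · intro j _
        have := mul_nonneg (hT j) hZ
        linarith
  refine h1.trans ?_
  rw [← Finset.prod_range_mul_prod_Ico _ (le_max_left K s)]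
  have h2 : ∏ j ∈ Finset.range K, (1 + T j * Z) ≤
      (∏ j ∈ Finset.range K, (1 + T j / e)) * Real.exp (ε / 2 * Z) := by
    have : ∏ j ∈ Finset.range K, (1 + T j * Z) ≤
        ∏ j ∈ Finset.range K, ((1 + T j / e) * Real.exp (e * Z)) := by
      apply Finset.prod_le_prod
      · intro j _; have := hT j; positivity
      · intro j _
        have h3 := Real.add_one_le_exp (e * Z)
        have h4 := hT j
        calc 1 + T j * Z ≤ (1 + T j / e) * (e * Z + 1) := by
              have : (1 + T j / e) * (e * Z + 1) = 1 + T j * Z + (e * Z + T j / e) := by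
                field_simp; ring
              rw [this]
              have : 0 ≤ e * Z + T j / e := by positivity
              linarith
          _ ≤ _ := by gcongr
    refine this.trans ?_
    rw [Finset.prod_mul_distrib, Finset.prod_const, Finset.card_range, ← Real.exp_nat_mul]
    apply mul_le_mul_of_nonneg_left
    · apply Real.exp_le_exp.2
      rw [← mul_assoc]
      apply mul_le_mul_of_nonneg_right _ hZ
      rw [he, mul_div_assoc', div_le_div_iff₀ (by positivity) (by norm_num)]
      nlinarith
    · exact Finset.prod_nonneg fun j _ => by have := hT j; positivity
  have h3 : ∏ j ∈ Finset.Ico K (max K s), (1 + T j * Z) ≤ Real.exp (ε / 2 * Z) := by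
    have : ∏ j ∈ Finset.Ico K (max K s), (1 + T j * Z) ≤
        ∏ j ∈ Finset.Ico K (max K s), Real.exp (T j * Z) := by
      apply Finset.prod_le_prod
      · intro j _; have := hT j; positivity
      · intro j _
        have := Real.add_one_le_exp (T j * Z)
        linarith
    refine this.trans ?_
    rw [← Real.exp_sum, ← Finset.sum_mul]
    apply Real.exp_le_exp.2
    apply mul_le_mul_of_nonneg_right _ hZ
    have := hJ (Finset.Ico K (max K s)) (by
      rw [Finset.disjoint_left]
      intro j hj hj2
      have := hK j hj2
      have := Finset.mem_Ico.1 hj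
      omega)
    exact (le_abs_self _).trans this.le
  calc _ ≤ ((∏ j ∈ Finset.range K, (1 + T j / e)) * Real.exp (ε / 2 * Z)) *
        Real.exp (ε / 2 * Z) := by
        apply mul_le_mul h2 h3
        · exact Finset.prod_nonneg fun j _ => by have := hT j; positivity
        · exact mul_nonneg (Finset.prod_nonneg fun j _ => by have := hT j; positivity)
            (Real.exp_pos _).le
    _ = _ := by
        rw [mul_assoc, ← Real.exp_add]
        congr 2
        ring

lemma rpow_sum_le {ι : Type*} (S : Finset ι) (f : ι → ℝ) (hf : ∀ i ∈ S, 0 ≤ f i) (α : ℝ)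
    (hα : 1 < α) : ∑ i ∈ S, f i ^ α ≤ (∑ i ∈ S, f i) ^ α := by
  set X := ∑ i ∈ S, f i with hX
  have hX0 : 0 ≤ X := Finset.sum_nonneg hf
  have e : ∀ y : ℝ, 0 ≤ y → y ^ α = y * y ^ (α - 1) := by
    intro y hy
    rcases hy.eq_or_lt with h | h
    · rw [← h, Real.zero_rpow (by linarith)]; simp
    · rw [Real.rpow_sub h, Real.rpow_one]; field_simp
  rw [e X hX0]
  conv_rhs => rw [hX, Finset.sum_mul]
  apply Finset.sum_le_sum
  intro i hi
  rw [e _ (hf i hi)]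
  apply mul_le_mul_of_nonneg_left _ (hf i hi)
  apply Real.rpow_le_rpow (hf i hi) _ (by linarith)
  exact Finset.single_le_sum hf hi

lemma rho_pos {s : ℕ} (η : Finset ℕ → ℝ) (hη : ∀ u, 0 < η u) (m : Fin s → ℤ) : 0 < rho η m := by
  apply mul_pos (hη _)
  apply Finset.prod_pos
  intro j hj
  have := (Finset.mem_filter.1 hj).2
  have : (m j : ℝ) ≠ 0 := by exact_mod_cast this
  positivity

lemma rweight_rho {s : ℕ} (η : Finset ℕ → ℝ) (hη : ∀ u, 0 < η u) (α : ℝ) (m : Fin s → ℤ) :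
    1 / rweight α (fun u => η u ^ α) m = rho η m ^ α := by
  rw [rweight, rho, Real.mul_rpow (hη _).le (Finset.prod_nonneg fun j _ => by positivity),
    ← Real.finsetProd_rpow _ _ (fun j _ => by positivity), one_div, mul_inv, inv_inv,
    ← Finset.prod_inv_distrib]
  congr 1
  apply Finset.prod_congr rfl
  intro j _
  rw [one_div, Real.inv_rpow (abs_nonneg _)]

lemma small_total (η : Finset ℕ → ℝ) (hη : ∀ u, 0 < η u) (h0 : η ∅ = 1)
    (n s : ℕ) (hn : 1 ≤ n) (z : ℕ → ℤ) (h : IsCBCDBD η n s z) (F : Finset (Fin s → ℤ))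
    (hF : ∀ m ∈ F, m ≠ 0 ∧ (∀ j, 2 * |m j| < (2 ^ n : ℕ)) ∧
      ((2 ^ n : ℕ) : ℤ) ∣ ∑ j : Fin s, m j * z ((j : ℕ) + 1)) :
    (2 : ℝ) ^ n * ∑ m ∈ F, rho η m ≤
      ∏ j ∈ Finset.range s, (1 + tildeW η (j + 1) * (4 * Real.log ((2 : ℝ) ^ n) + 6)) := by
  set Z := 4 * Real.log ((2 : ℝ) ^ n) + 6 with hZ
  have hZ0 : 0 ≤ Z := by
    have : 0 ≤ Real.log ((2 : ℝ) ^ n) := Real.log_nonneg (one_le_pow₀ (by norm_num))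
    linarith
  obtain ⟨hodd, hcbc⟩ := cbc_main η hη n s hn z h
  have h1 : ∑ m ∈ F, rho η m ≤ ∑ r ∈ Finset.Icc 1 s, ∑ u ∈ (Finset.Icc 1 (r - 1)).powerset,
      ∑ m ∈ F.filter (fun m => msupp m = u ∪ {r}), rho η m := by
    have e : ∑ r ∈ Finset.Icc 1 s, ∑ u ∈ (Finset.Icc 1 (r - 1)).powerset,
        ∑ m ∈ F.filter (fun m => msupp m = u ∪ {r}), rho η m =
        ∑ m ∈ F, ∑ r ∈ Finset.Icc 1 s, ∑ u ∈ (Finset.Icc 1 (r - 1)).powerset,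
          if msupp m = u ∪ {r} then rho η m else 0 := by
      simp only [Finset.sum_filter]
      rw [Finset.sum_comm]
      apply Finset.sum_congr rfl
      intro r _
      rw [Finset.sum_comm]
    rw [e]
    apply Finset.sum_le_sum
    intro m hm
    have hne : (msupp m).Nonempty := by
      obtain ⟨j, hj⟩ := Function.ne_iff.1 (hF m hm).1
      exact ⟨_, (mem_msupp m j).2 hj⟩
    set r := (msupp m).max' hne with hr
    have hrm : r ∈ msupp m := Finset.max'_mem _ _
    have hu : (msupp m).erase r ∈ (Finset.Icc 1 (r - 1)).powerset := by
      rw [Finset.mem_powerset]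
      intro i hi
      have h1 := Finset.mem_Icc.1 (msupp_sub m (Finset.mem_of_mem_erase hi))
      have h2 := Finset.le_max' _ i (Finset.mem_of_mem_erase hi)
      have h3 := Finset.ne_of_mem_erase hi
      rw [← hr] at h2
      exact Finset.mem_Icc.2 (by omega)
    have hnn : ∀ (r : ℕ) (u : Finset ℕ), 0 ≤ if msupp m = u ∪ {r} then rho η m else 0 := by
      intro r u
      split_ifs
      · exact (rho_pos η hη m).le
      · exact le_rfl
    calc rho η m = if msupp m = (msupp m).erase r ∪ {r} then rho η m else 0 := by
          rw [if_pos]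
          ext i
          simp only [Finset.mem_union, Finset.mem_erase, Finset.mem_singleton]
          constructor
          · intro hi
            by_cases hir : i = r
            · exact Or.inr hir
            · exact Or.inl ⟨hir, hi⟩
          · rintro (hi | hi)
            · exact hi.2
            · rw [hi]; exact hrm
      _ ≤ ∑ u ∈ (Finset.Icc 1 (r - 1)).powerset, if msupp m = u ∪ {r} then rho η m else 0 :=
          Finset.single_le_sum (f := fun u => if msupp m = u ∪ {r} then rho η m else 0)
            (fun u _ => hnn r u) hu
      _ ≤ _ := Finset.single_le_sum
          (f := fun r => ∑ u ∈ (Finset.Icc 1 (r - 1)).powerset,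
            if msupp m = u ∪ {r} then rho η m else 0)
          (fun r _ => Finset.sum_nonneg fun u _ => hnn r u) (msupp_sub m hrm)
  have h2 : ∀ r ∈ Finset.Icc 1 s, (2 : ℝ) ^ n * ∑ u ∈ (Finset.Icc 1 (r - 1)).powerset,
      ∑ m ∈ F.filter (fun m => msupp m = u ∪ {r}), rho η m ≤
      ∑ u ∈ (Finset.Icc 1 (r - 1)).powerset, (tildeW η r * Z) * ∏ j ∈ u, (tildeW η j * Z) := by
    intro r hr
    refine (small_r η hη n s hn z hodd r hr (hcbc r hr) F (fun m hm => (hF m hm).2)).trans ?_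
    apply Finset.sum_le_sum
    intro u hu
    rw [Finset.mem_powerset] at hu
    have hr' := Finset.mem_Icc.1 hr
    have hru : r ∉ u := fun h => by
      have := Finset.mem_Icc.1 (hu h)
      omega
    have e1 := eta_le η hη h0 (u ∪ {r}) (by
      intro j hj
      rcases Finset.mem_union.1 hj with h | h
      · exact (Finset.mem_Icc.1 (hu h)).1
      · rw [Finset.mem_singleton.1 h]; exact hr'.1)
    rw [Finset.union_comm, ← Finset.insert_eq, Finset.prod_insert hru] at e1
    rw [Finset.union_comm, ← Finset.insert_eq, Finset.prod_mul_distrib, Finset.prod_const]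
    refine (mul_le_mul_of_nonneg_right e1 (by positivity)).trans (le_of_eq ?_)
    rw [← hZ]
    ring
  have h3 := tele (fun j => tildeW η j * Z) s
  have h4 : ∏ j ∈ Finset.Icc 1 s, (1 + tildeW η j * Z) =
      ∏ j ∈ Finset.range s, (1 + tildeW η (j + 1) * Z) := by
    rw [← prod_fin_Icc s (fun j => 1 + tildeW η j * Z),
      Fin.prod_univ_eq_prod_range (fun j => 1 + tildeW η (j + 1) * Z) s]
  rw [h4] at h3
  have h5 := Finset.sum_le_sum h2
  rw [h3, ← Finset.mul_sum] at h5
  have h6 := mul_le_mul_of_nonneg_left h1 (show (0 : ℝ) ≤ 2 ^ n by positivity)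
  linarith

lemma box_sum {s : ℕ} (g : Fin s → ℤ → ℝ) (hg : ∀ i h, 0 ≤ g i h) (B : Fin s → ℝ)
    (hB : ∀ i, ∀ S : Finset ℤ, ∑ h ∈ S, g i h ≤ B i) (F : Finset (Fin s → ℤ)) :
    ∑ m ∈ F, ∏ i, g i (m i) ≤ ∏ i, B i := by
  calc ∑ m ∈ F, ∏ i, g i (m i) ≤
      ∑ m ∈ Fintype.piFinset (fun i => F.image (fun m => m i)), ∏ i, g i (m i) := by
        apply Finset.sum_le_sum_of_subset_of_nonneg
        · intro m hm
          rw [Fintype.mem_piFinset]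
          intro i
          exact Finset.mem_image_of_mem _ hm
        · intro m _ _
          exact Finset.prod_nonneg fun i _ => hg i _
    _ = ∏ i, ∑ h ∈ F.image (fun m => m i), g i h := (Finset.prod_univ_sum _ _).symm
    _ ≤ _ := Finset.prod_le_prod (fun i _ => Finset.sum_nonneg fun h _ => hg i h)
        (fun i _ => hB i _)

/-- `W = ∑_h |h|^{-α}`. -/
def WW (α : ℝ) : ℝ := ∑' h : ℤ, |(h : ℝ)| ^ (-α)

lemma WW_nonneg (α : ℝ) : 0 ≤ WW α := tsum_nonneg fun h => by positivity

lemma WW_sum (α : ℝ) (hα : 1 < α) (S : Finset ℤ) : ∑ h ∈ S, |(h : ℝ)| ^ (-α) ≤ WW α :=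
  (Real.summable_abs_int_rpow hα).sum_le_tsum S (fun h _ => by positivity)

/-- One-dimensional majorant. -/
def gg (α t : ℝ) (h : ℤ) : ℝ := if h = 0 then 1 else t * |(h : ℝ)| ^ (-α)

lemma gg_nonneg (α t : ℝ) (ht : 0 ≤ t) (h : ℤ) : 0 ≤ gg α t h := by
  unfold gg; split_ifs <;> positivity

lemma sum_delta (S : Finset ℤ) : ∑ h ∈ S, (if h = 0 then (1 : ℝ) else 0) ≤ 1 := by
  rw [Finset.sum_ite_eq' S 0 (fun _ => (1 : ℝ))]
  split_ifs <;> norm_num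

lemma gg_sum (α t : ℝ) (hα : 1 < α) (ht : 0 ≤ t) (S : Finset ℤ) :
    ∑ h ∈ S, gg α t h ≤ 1 + t * WW α := by
  have : ∀ h ∈ S, gg α t h ≤ (if h = 0 then (1 : ℝ) else 0) + t * |(h : ℝ)| ^ (-α) := by
    intro h _
    unfold gg
    split_ifs
    · have : 0 ≤ t * |(h : ℝ)| ^ (-α) := by positivity
      linarith
    · linarith
  refine (Finset.sum_le_sum this).trans ?_
  rw [Finset.sum_add_distrib, ← Finset.mul_sum]
  have h1 := mul_le_mul_of_nonneg_left (WW_sum α hα S) ht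
  have h2 := sum_delta S
  linarith

lemma bb_sum (α : ℝ) (hα : 1 < α) (S : Finset ℤ) :
    ∑ h ∈ S, (1 + |(h : ℝ)|) ^ (-α) ≤ 1 + WW α := by
  have : ∀ h ∈ S, (1 + |(h : ℝ)|) ^ (-α) ≤ (if h = 0 then (1 : ℝ) else 0) + |(h : ℝ)| ^ (-α) := by
    intro h _
    by_cases h0 : h = 0
    · rw [if_pos h0, h0]
      simp only [Int.cast_zero, abs_zero, add_zero, Real.one_rpow]
      have : (0 : ℝ) ≤ 0 ^ (-α) := by positivity
      linarith
    · rw [if_neg h0, zero_add]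
      have h1 : (h : ℝ) ≠ 0 := by exact_mod_cast h0
      apply Real.rpow_le_rpow_of_nonpos (by positivity) (by linarith) (by linarith)
  refine (Finset.sum_le_sum this).trans ?_
  rw [Finset.sum_add_distrib]
  have h1 := WW_sum α hα S
  have h2 := sum_delta S
  linarith

lemma rho_le {s : ℕ} (η : Finset ℕ → ℝ) (hη : ∀ u, 0 < η u) (h0 : η ∅ = 1) (α : ℝ) (hα : 1 < α)
    (m : Fin s → ℤ) : rho η m ^ α ≤ ∏ i : Fin s, gg α (tildeW η ((i : ℕ) + 1) ^ α) (m i) := by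
  have h1 : rho η m ≤ ∏ i : Fin s, if m i ≠ 0 then tildeW η ((i : ℕ) + 1) * (1 / |(m i : ℝ)|)
      else 1 := by
    have e := eta_le η hη h0 (msupp m) (fun j hj => (Finset.mem_Icc.1 (msupp_sub m hj)).1)
    rw [← Finset.prod_filter, Finset.prod_mul_distrib, rho]
    apply mul_le_mul_of_nonneg_right _ (Finset.prod_nonneg fun j _ => by positivity)
    refine e.trans (le_of_eq ?_)
    unfold msupp
    rw [Finset.prod_image]
    intro a _ b _ h
    exact Fin.ext (by simpa using h)
  refine (Real.rpow_le_rpow (rho_pos η hη m).le h1 (by linarith)).trans (le_of_eq ?_)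
  have hnn : ∀ i ∈ (Finset.univ : Finset (Fin s)),
      0 ≤ if m i ≠ 0 then tildeW η ((i : ℕ) + 1) * (1 / |(m i : ℝ)|) else 1 := by
    intro i _
    have := tildeW_pos η hη ((i : ℕ) + 1)
    split_ifs <;> positivity
  rw [← Real.finsetProd_rpow _ _ hnn]
  apply Finset.prod_congr rfl
  intro i _
  unfold gg
  by_cases hi : m i = 0
  · simp [hi]
  · rw [if_pos hi, if_neg hi, Real.mul_rpow (tildeW_pos η hη _).le (by positivity), one_div,
      Real.inv_rpow (abs_nonneg _), Real.rpow_neg (abs_nonneg _)]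

lemma large_coord (N : ℕ) (hN : 0 < N) (m : ℤ) (hm : (N : ℤ) ≤ 2 * |m|) :
    (N : ℝ) / 5 * (1 + |((m / N : ℤ) : ℝ)|) ≤ |(m : ℝ)| := by
  have hN' : (0 : ℤ) < N := by exact_mod_cast hN
  have h1 := Int.emod_add_mul_ediv m N
  have h2 := Int.emod_nonneg m hN'.ne'
  have h3 := Int.emod_lt_of_pos m hN'
  have key : (N : ℤ) * |m / N| ≤ |m| + N := by
    have : (N : ℤ) * |m / N| = |N * (m / N)| := by rw [abs_mul, abs_of_pos hN']
    rw [this]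
    have e : (N : ℤ) * (m / N) = m - m % N := by linarith
    rw [e]
    have := abs_sub m (m % N)
    rw [abs_of_nonneg h2] at this
    linarith
  have key2 : (N : ℤ) * (1 + |m / N|) ≤ 5 * |m| := by linarith
  have : (N : ℝ) * (1 + |((m / N : ℤ) : ℝ)|) ≤ 5 * |(m : ℝ)| := by exact_mod_cast key2
  linarith

lemma large_j (α : ℝ) (hα : 1 < α) (N s : ℕ) (hN : 0 < N) (z : Fin s → ℤ) (t : Fin s → ℝ)
    (ht : ∀ i, 0 ≤ t i) (j : Fin s) (hz : IsCoprime (N : ℤ) (z j)) (F : Finset (Fin s → ℤ))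
    (hF : ∀ m ∈ F, (N : ℤ) ≤ 2 * |m j| ∧ (N : ℤ) ∣ ∑ i, m i * z i) :
    ∑ m ∈ F, ∏ i, gg α (t i) (m i) ≤
      t j * ((N : ℝ) / 5) ^ (-α) * (1 + WW α) * ∏ i, (1 + t i * WW α) := by
  classical
  have hN' : (0 : ℝ) < N := by exact_mod_cast hN
  set g' : Fin s → ℤ → ℝ := fun i => if i = j then fun b => (1 + |(b : ℝ)|) ^ (-α) else gg α (t i)
    with hg'
  have h1 : ∀ m ∈ F, ∏ i, gg α (t i) (m i) ≤
      t j * ((N : ℝ) / 5) ^ (-α) * ∏ i, g' i (Function.update m j (m j / N) i) := by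
    intro m hm
    rw [← Finset.mul_prod_erase _ _ (Finset.mem_univ j),
      ← Finset.mul_prod_erase Finset.univ (fun i => g' i _) (Finset.mem_univ j), ← mul_assoc]
    have e : ∏ i ∈ Finset.univ.erase j, g' i (Function.update m j (m j / N) i) =
        ∏ i ∈ Finset.univ.erase j, gg α (t i) (m i) := by
      apply Finset.prod_congr rfl
      intro i hi
      have := Finset.ne_of_mem_erase hi
      simp [hg', this]
    rw [e]
    apply mul_le_mul_of_nonneg_right _ (Finset.prod_nonneg fun i _ => gg_nonneg _ _ (ht i) _)
    simp only [hg', if_true, Function.update_self]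
    have hl := large_coord N hN (m j) (hF m hm).1
    have hm0 : m j ≠ 0 := by
      intro h0
      have := (hF m hm).1
      rw [h0] at this
      simp at this
      omega
    rw [gg, if_neg hm0, mul_assoc]
    apply mul_le_mul_of_nonneg_left _ (ht j)
    rw [← Real.mul_rpow (by positivity) (by positivity)]
    apply Real.rpow_le_rpow_of_nonpos (by positivity) hl (by linarith)
  refine (Finset.sum_le_sum h1).trans ?_
  rw [← Finset.mul_sum, mul_assoc (t j * _)]
  have hW := WW_nonneg α
  apply mul_le_mul_of_nonneg_left _ (mul_nonneg (ht j) (by positivity))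
  have inj : Set.InjOn (fun m : Fin s → ℤ => Function.update m j (m j / N)) F := by
    intro m hm m' hm' h
    have hi : ∀ i, i ≠ j → m i = m' i := by
      intro i hi
      have := congrFun h i
      simpa [hi] using this
    have hj : m j / N = m' j / N := by
      have := congrFun h j
      simpa using this
    have hd : (N : ℤ) ∣ (m j - m' j) * z j := by
      have := dvd_sub (hF m hm).2 (hF m' hm').2
      rw [← Finset.sum_sub_distrib, Finset.sum_eq_single j] at this
      · rw [sub_mul]; exact this
      · intro i _ hij
        rw [hi i hij]; ring
      · intro hh; exact absurd (Finset.mem_univ _) hh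
    have hd2 := hz.dvd_of_dvd_mul_right hd
    have hmod : m j % N = m' j % N := 
      Int.emod_eq_emod_iff_emod_sub_eq_zero.2 (Int.emod_eq_zero_of_dvd hd2)
    have h5 := Int.emod_add_mul_ediv (m j) N
    have h6 := Int.emod_add_mul_ediv (m' j) N
    funext i
    by_cases hij : i = j
    · rw [hij, ← h5, ← h6, hj, hmod]
    · exact hi i hij
  have e := Finset.sum_image (f := fun m : Fin s → ℤ => ∏ i, g' i (m i)) inj
  rw [← e]
  refine (box_sum g' ?_ (fun i => if i = j then 1 + WW α else 1 + t i * WW α) ?_ _).trans ?_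
  · intro i h
    simp only [hg']
    split_ifs
    · positivity
    · exact gg_nonneg _ _ (ht i) _
  · intro i S
    simp only [hg']
    split_ifs
    · exact bb_sum α hα S
    · exact gg_sum α _ hα (ht i) S
  · rw [← Finset.mul_prod_erase _ _ (Finset.mem_univ j), if_pos rfl]
    apply mul_le_mul_of_nonneg_left _ (by linarith)
    rw [← Finset.mul_prod_erase Finset.univ (fun i => 1 + t i * WW α) (Finset.mem_univ j)]
    have e2 : ∏ i ∈ Finset.univ.erase j, (if i = j then 1 + WW α else 1 + t i * WW α) =
        ∏ i ∈ Finset.univ.erase j, (1 + t i * WW α) := by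
      apply Finset.prod_congr rfl
      intro i hi
      rw [if_neg (Finset.ne_of_mem_erase hi)]
    rw [e2]
    apply le_mul_of_one_le_left
    · exact Finset.prod_nonneg fun i _ => by have := ht i; positivity
    · have := mul_nonneg (ht j) hW
      linarith

lemma large_total (α : ℝ) (hα : 1 < α) (N s : ℕ) (hN : 0 < N) (z : Fin s → ℤ) (t : Fin s → ℝ)
    (ht : ∀ i, 0 ≤ t i) (A : ℝ) (hA : ∑ i, t i ≤ A) (hz : ∀ j, IsCoprime (N : ℤ) (z j))
    (F : Finset (Fin s → ℤ))
    (hF : ∀ m ∈ F, (∃ j, (N : ℤ) ≤ 2 * |m j|) ∧ (N : ℤ) ∣ ∑ i, m i * z i) :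
    ∑ m ∈ F, ∏ i, gg α (t i) (m i) ≤
      A * ((N : ℝ) / 5) ^ (-α) * (1 + WW α) * Real.exp (A * WW α) := by
  have hW := WW_nonneg α
  have hA0 : 0 ≤ A := (Finset.sum_nonneg fun i _ => ht i).trans hA
  have hN' : (0 : ℝ) < N := by exact_mod_cast hN
  have hg : ∀ m : Fin s → ℤ, 0 ≤ ∏ i, gg α (t i) (m i) := fun m =>
    Finset.prod_nonneg fun i _ => gg_nonneg _ _ (ht i) _
  have h1 : ∑ m ∈ F, ∏ i, gg α (t i) (m i) ≤
      ∑ j, ∑ m ∈ F.filter (fun m => (N : ℤ) ≤ 2 * |m j|), ∏ i, gg α (t i) (m i) := by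
    simp only [Finset.sum_filter]
    rw [Finset.sum_comm]
    apply Finset.sum_le_sum
    intro m hm
    obtain ⟨j, hj⟩ := (hF m hm).1
    calc ∏ i, gg α (t i) (m i) =
        if (N : ℤ) ≤ 2 * |m j| then ∏ i, gg α (t i) (m i) else 0 := (if_pos hj).symm
      _ ≤ _ := Finset.single_le_sum
        (f := fun j => if (N : ℤ) ≤ 2 * |m j| then ∏ i, gg α (t i) (m i) else 0)
        (fun i _ => by split_ifs; exacts [hg m, le_rfl]) (Finset.mem_univ j)
  refine h1.trans ?_
  have hP : ∏ i, (1 + t i * WW α) ≤ Real.exp (A * WW α) := by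
    calc ∏ i, (1 + t i * WW α) ≤ ∏ i, Real.exp (t i * WW α) := by
          apply Finset.prod_le_prod
          · intro i _; have := ht i; positivity
          · intro i _
            have := Real.add_one_le_exp (t i * WW α)
            linarith
      _ = Real.exp ((∑ i, t i) * WW α) := by rw [← Real.exp_sum, Finset.sum_mul]
      _ ≤ _ := by gcongr
  have h2 : ∀ j ∈ (Finset.univ : Finset (Fin s)),
      ∑ m ∈ F.filter (fun m => (N : ℤ) ≤ 2 * |m j|), ∏ i, gg α (t i) (m i) ≤
      t j * (((N : ℝ) / 5) ^ (-α) * (1 + WW α) * Real.exp (A * WW α)) := by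
    intro j _
    refine (large_j α hα N s hN z t ht j (hz j) _ (fun m hm => ?_)).trans ?_
    · have := Finset.mem_filter.1 hm
      exact ⟨this.2, (hF m this.1).2⟩
    · rw [mul_assoc (t j), mul_assoc (t j)]
      apply mul_le_mul_of_nonneg_left _ (ht j)
      apply mul_le_mul_of_nonneg_left hP (by positivity)
  refine (Finset.sum_le_sum h2).trans ?_
  rw [← Finset.sum_mul]
  have := mul_le_mul_of_nonneg_right hA
    (show 0 ≤ ((N : ℝ) / 5) ^ (-α) * (1 + WW α) * Real.exp (A * WW α) by positivity)
  refine this.trans (le_of_eq ?_)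
  ring

lemma final_bound (η : Finset ℕ → ℝ) (hηpos : ∀ u, 0 < η u) (hηempty : η ∅ = 1)
    (hsum : Summable fun j : ℕ => tildeW η (j + 1)) (δ : ℝ) (hδ : 0 < δ) (α : ℝ) (hα : 1 < α) :
    ∃ Cα > (0 : ℝ), ∃ Cδ > (0 : ℝ),
      ∀ n s : ℕ, 1 ≤ n → 1 ≤ s → ∀ z : ℕ → ℤ, IsCBCDBD η n s z →
        wce (2 ^ n) s α (fun u => η u ^ α) z ≤
          Cα / ((2 : ℝ) ^ n) ^ α + Cδ ^ α / ((2 : ℝ) ^ n) ^ (α * (1 - δ)) := by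
  have hT : ∀ j : ℕ, 0 ≤ tildeW η (j + 1) := fun j => (tildeW_pos η hηpos _).le
  obtain ⟨C, hC, hgrow⟩ := prod_growth (fun j => tildeW η (j + 1)) hT hsum (δ / 4) (by positivity)
  set A : ℝ := (∑' j : ℕ, tildeW η (j + 1)) ^ α with hA
  have hA0 : 0 ≤ A := Real.rpow_nonneg (tsum_nonneg hT) _
  have hW := WW_nonneg α
  refine ⟨A * 5 ^ α * (1 + WW α) * Real.exp (A * WW α) + 1, by positivity,
    C * Real.exp (δ / 4 * 6), by positivity, ?_⟩
  intro n s hn _ z hz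
  have hX : (0 : ℝ) < (2 : ℝ) ^ n := by positivity
  set R := (A * 5 ^ α * (1 + WW α) * Real.exp (A * WW α) + 1) / ((2 : ℝ) ^ n) ^ α +
    (C * Real.exp (δ / 4 * 6)) ^ α / ((2 : ℝ) ^ n) ^ (α * (1 - δ)) with hR
  have hR0 : 0 ≤ R := by positivity
  obtain ⟨hodd, -⟩ := cbc_main η hηpos n s hn z hz
  set t : Fin s → ℝ := fun i => tildeW η ((i : ℕ) + 1) ^ α with ht
  have ht0 : ∀ i, 0 ≤ t i := fun i => Real.rpow_nonneg (hT _) _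
  have htA : ∑ i, t i ≤ A := by
    have h1 := rpow_sum_le (Finset.range s) (fun j => tildeW η (j + 1)) (fun j _ => hT j) α hα
    rw [ht, Fin.sum_univ_eq_sum_range (fun j => tildeW η (j + 1) ^ α) s]
    refine h1.trans ?_
    exact Real.rpow_le_rpow (Finset.sum_nonneg fun j _ => hT j)
      (hsum.sum_le_tsum _ fun j _ => hT j) (by linarith)
  have hcop : ∀ j : Fin s, IsCoprime ((2 ^ n : ℕ) : ℤ) (z ((j : ℕ) + 1)) := by
    intro j
    push_cast
    apply IsCoprime.pow_left
    have := j.2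
    obtain ⟨q, hq⟩ := hodd ((j : ℕ) + 1) (Finset.mem_Icc.2 (by omega))
    exact ⟨-q, 1, by rw [hq]; ring⟩
  have hB : ∀ F : Finset (Fin s → ℤ), (∀ m ∈ F, m ≠ 0 ∧
      ((2 ^ n : ℕ) : ℤ) ∣ ∑ j : Fin s, m j * z ((j : ℕ) + 1)) → ∑ m ∈ F, rho η m ^ α ≤ R := by
    intro F hF
    rw [← Finset.sum_filter_add_sum_filter_not F
      (fun m => ∃ j, ((2 ^ n : ℕ) : ℤ) ≤ 2 * |m j|)]
    have hlarge : ∑ m ∈ F.filter (fun m => ∃ j, ((2 ^ n : ℕ) : ℤ) ≤ 2 * |m j|), rho η m ^ α ≤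
        (A * 5 ^ α * (1 + WW α) * Real.exp (A * WW α) + 1) / ((2 : ℝ) ^ n) ^ α := by
      refine (Finset.sum_le_sum fun m _ => rho_le η hηpos hηempty α hα m).trans ?_
      refine (large_total α hα (2 ^ n) s (by positivity) (fun j => z ((j : ℕ) + 1)) t ht0 A htA hcop
        _ (fun m hm => ?_)).trans ?_
      · have := Finset.mem_filter.1 hm
        exact ⟨this.2, (hF m this.1).2⟩
      · push_cast
        rw [Real.rpow_neg (by positivity), Real.div_rpow hX.le (by norm_num), inv_div,
          le_div_iff₀ (by positivity)]
        have : A * (5 ^ α / ((2 : ℝ) ^ n) ^ α) * (1 + WW α) * Real.exp (A * WW α) *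
            ((2 : ℝ) ^ n) ^ α = A * 5 ^ α * (1 + WW α) * Real.exp (A * WW α) := by
          have : ((2 : ℝ) ^ n) ^ α ≠ 0 := by positivity
          field_simp
        rw [this]
        linarith
    have hsmall : ∑ m ∈ F.filter (fun m => ¬ ∃ j, ((2 ^ n : ℕ) : ℤ) ≤ 2 * |m j|), rho η m ^ α ≤
        (C * Real.exp (δ / 4 * 6)) ^ α / ((2 : ℝ) ^ n) ^ (α * (1 - δ)) := by
      refine (rpow_sum_le _ _ (fun m _ => (rho_pos η hηpos m).le) α hα).trans ?_
      have h1 := small_total η hηpos hηempty n s hn z hz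
        (F.filter (fun m => ¬ ∃ j, ((2 ^ n : ℕ) : ℤ) ≤ 2 * |m j|)) (by
          intro m hm
          have h2 := Finset.mem_filter.1 hm
          refine ⟨(hF m h2.1).1, ?_, (hF m h2.1).2⟩
          intro j
          by_contra hcon
          exact h2.2 ⟨j, not_lt.1 hcon⟩)
      have hlog : 0 ≤ Real.log ((2 : ℝ) ^ n) := Real.log_nonneg (one_le_pow₀ (by norm_num))
      have h2 := hgrow s (4 * Real.log ((2 : ℝ) ^ n) + 6) (by linarith)
      have e : Real.exp (δ / 4 * (4 * Real.log ((2 : ℝ) ^ n) + 6)) =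
          Real.exp (δ / 4 * 6) * ((2 : ℝ) ^ n) ^ δ := by
        rw [Real.rpow_def_of_pos hX, ← Real.exp_add]
        congr 1
        ring
      rw [e, ← mul_assoc] at h2
      have h3 := h1.trans h2
      have h4 : ∑ m ∈ F.filter (fun m => ¬ ∃ j, ((2 ^ n : ℕ) : ℤ) ≤ 2 * |m j|), rho η m ≤
          C * Real.exp (δ / 4 * 6) / ((2 : ℝ) ^ n) ^ (1 - δ) := by
        rw [Real.rpow_sub hX, Real.rpow_one, div_div_eq_mul_div, le_div_iff₀ hX]
        linarith
      refine (Real.rpow_le_rpow (Finset.sum_nonneg fun m _ => (rho_pos η hηpos m).le) h4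
        (by linarith)).trans (le_of_eq ?_)
      rw [Real.div_rpow (by positivity) (by positivity), ← Real.rpow_mul hX.le, mul_comm (1 - δ) α]
    exact add_le_add hlarge hsmall
  have hsummable : Summable (fun m : Fin s → ℤ => rho η m ^ α) := by
    apply summable_of_sum_le (c := ∏ i, (1 + t i * WW α))
    · intro m
      exact Real.rpow_nonneg (rho_pos η hηpos m).le _
    · intro F
      refine (Finset.sum_le_sum fun m _ => rho_le η hηpos hηempty α hα m).trans ?_
      exact box_sum (fun i => gg α (t i)) (fun i h => gg_nonneg _ _ (ht0 i) h) _
        (fun i S => gg_sum α _ hα (ht0 i) S) F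
  unfold wce
  apply Real.iSup_le _ hR0
  intro f
  apply Real.iSup_le _ hR0
  rintro ⟨hf, hfm⟩
  have hfc : ∀ m, ‖fcoeff s f m‖ ≤ rho η m ^ α := by
    intro m
    rw [← rweight_rho η hηpos]
    have hp : 0 < rweight α (fun u => η u ^ α) m := by
      have := rweight_rho η hηpos α m
      have h2 : 0 < rho η m ^ α := Real.rpow_pos_of_pos (rho_pos η hηpos m) _
      rw [← this] at h2
      exact one_div_pos.1 h2
    rw [le_div_iff₀ hp]
    exact hfm m
  exact err_bound s (2 ^ n) (by positivity) z f hf (Summable.of_norm_bounded hsummable hfc) _ hfc R hB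

/-- Corollary 1: let `η` be strictly positive weights with
`∑_{j≥1} η̃_j < ∞`. For `N = 2^n` and `z` constructed by the CBC-DBD algorithm with
weights `η`, for every `δ > 0` and `α > 1` there exist constants `C_α, C_δ > 0`,
independent of `s` and `N`, with
`e_{N,s,α,η^α}(z) ≤ C_α/N^α + C_δ^α/N^{α(1-δ)}`. -/
theorem statement13 (η : Finset ℕ → ℝ) (hηpos : ∀ u, 0 < η u) (hηempty : η ∅ = 1)
    (hsum : Summable fun j : ℕ => tildeW η (j + 1)) :
    ∀ δ > (0 : ℝ), ∀ α : ℝ, 1 < α →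
      ∃ Cα > (0 : ℝ), ∃ Cδ > (0 : ℝ),
        ∀ n s : ℕ, 1 ≤ n → 1 ≤ s → ∀ z : ℕ → ℤ, IsCBCDBD η n s z →
          wce (2 ^ n) s α (fun u => η u ^ α) z ≤
            Cα / ((2 : ℝ) ^ n) ^ α + Cδ ^ α / ((2 : ℝ) ^ n) ^ (α * (1 - δ)) := by
  intro δ hδ α hα
  exact final_bound η hηpos hηempty hsum δ hδ α hα

end
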